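/- Let 𝖠 = D^{−1}A (the random-walk normalized adjacency matrix), suppose |σ'|≤1, |σ''|≤1, 0 < c₂ ≤ 1, w ≤ 1, and ω/w + c₁ + c₂ ≤ 1. Let v≠u, r := d_G(v,u), γ' := d_max/d_min, μ' := 1 + 2c^{(2)}(1+γ'), and |1−c₂λ*| := max_{1≤ℓ≤n−1}|1−c₂λ_ℓ| < 1. If there exist an input X and coordinates 1≤α,β≤d with |∂²y^{(m)}(X)/∂x_v^α∂x_u^β| ≥ M > 0, then the depth m satisfies m ≥ τ(v,u)/(4c₂) + (|E|/√(d_v d_u))·( M/(γ'μ') − (1/c₂)·( (γ' + |1−c₂λ*|^{r−1})/λ₁ + 2c^{(2)}/μ' ) ). -/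

import Mathlib

open scoped BigOperators

noncomputable section

namespace OSQ

variable {n d : ℕ}

/-- componentwise application of the activation function. -/
def act (σ : ℝ → ℝ) (x : EuclideanSpace ℝ (Fin d)) : EuclideanSpace ℝ (Fin d) :=
  WithLp.toLp 2 (fun i => σ (x i))

/-- node features computed by the MPNN after `t` layers. -/
def mpnn (σ : ℝ → ℝ) (𝒜 : Matrix (Fin n) (Fin n) ℝ)
    (Ω W : ℕ → EuclideanSpace ℝ (Fin d) →L[ℝ] EuclideanSpace ℝ (Fin d))
    (ψ : ℕ → EuclideanSpace ℝ (Fin d) × EuclideanSpace ℝ (Fin d) → EuclideanSpace ℝ (Fin d)) :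
    ℕ → (Fin n → EuclideanSpace ℝ (Fin d)) → Fin n → EuclideanSpace ℝ (Fin d)
  | 0, X, v => X v
  | (t+1), X, v =>
    act σ (Ω (t+1) (mpnn σ 𝒜 Ω W ψ t X v)
      + W (t+1) (∑ u : Fin n, 𝒜 v u • ψ (t+1) (mpnn σ 𝒜 Ω W ψ t X v, mpnn σ 𝒜 Ω W ψ t X u)))

/-- coordinate direction in the input space: a perturbation of entry `β` of the
feature of node `u`. -/
def dir (u : Fin n) (β : Fin d) : Fin n → EuclideanSpace ℝ (Fin d) :=
  Pi.single u (EuclideanSpace.single β 1)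

/-- `∂ h_v^{(m),α} / ∂ x_u^β`. -/
def jacEntry (σ : ℝ → ℝ) (𝒜 : Matrix (Fin n) (Fin n) ℝ)
    (Ω W : ℕ → EuclideanSpace ℝ (Fin d) →L[ℝ] EuclideanSpace ℝ (Fin d))
    (ψ : ℕ → EuclideanSpace ℝ (Fin d) × EuclideanSpace ℝ (Fin d) → EuclideanSpace ℝ (Fin d))
    (m : ℕ) (v u : Fin n) (X : Fin n → EuclideanSpace ℝ (Fin d)) (α β : Fin d) : ℝ :=
  fderiv ℝ (fun Y => mpnn σ 𝒜 Ω W ψ m Y v α) X (dir u β)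

/-- `∂² h_i^{(m),α} / ∂ x_v^β ∂ x_u^γ`. -/
def hessEntry (σ : ℝ → ℝ) (𝒜 : Matrix (Fin n) (Fin n) ℝ)
    (Ω W : ℕ → EuclideanSpace ℝ (Fin d) →L[ℝ] EuclideanSpace ℝ (Fin d))
    (ψ : ℕ → EuclideanSpace ℝ (Fin d) × EuclideanSpace ℝ (Fin d) → EuclideanSpace ℝ (Fin d))
    (m : ℕ) (i v u : Fin n) (X : Fin n → EuclideanSpace ℝ (Fin d)) (α β γ : Fin d) : ℝ :=
  fderiv ℝ (fun Y => fderiv ℝ (fun Z => mpnn σ 𝒜 Ω W ψ m Z i α) Y (dir u γ)) X (dir v β)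

/-- graph-level prediction with SUM readout: `y(X) = θᵀ Σ_v h_v^{(m)}`. -/
def readout (θ : EuclideanSpace ℝ (Fin d)) (σ : ℝ → ℝ) (𝒜 : Matrix (Fin n) (Fin n) ℝ)
    (Ω W : ℕ → EuclideanSpace ℝ (Fin d) →L[ℝ] EuclideanSpace ℝ (Fin d))
    (ψ : ℕ → EuclideanSpace ℝ (Fin d) × EuclideanSpace ℝ (Fin d) → EuclideanSpace ℝ (Fin d))
    (m : ℕ) (X : Fin n → EuclideanSpace ℝ (Fin d)) : ℝ :=
  ∑ α : Fin d, θ α * (∑ v : Fin n, mpnn σ 𝒜 Ω W ψ m X v) α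

/-- `∂² y^{(m)} / ∂ x_v^α ∂ x_u^β`. -/
def mixEntry (θ : EuclideanSpace ℝ (Fin d)) (σ : ℝ → ℝ) (𝒜 : Matrix (Fin n) (Fin n) ℝ)
    (Ω W : ℕ → EuclideanSpace ℝ (Fin d) →L[ℝ] EuclideanSpace ℝ (Fin d))
    (ψ : ℕ → EuclideanSpace ℝ (Fin d) × EuclideanSpace ℝ (Fin d) → EuclideanSpace ℝ (Fin d))
    (m : ℕ) (v u : Fin n) (X : Fin n → EuclideanSpace ℝ (Fin d)) (α β : Fin d) : ℝ :=
  fderiv ℝ (fun Y => fderiv ℝ (fun Z => readout θ σ 𝒜 Ω W ψ m Z) Y (dir u β)) X (dir v α)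

/-- the matrix `S := (ω/w)I + c₁ diag(𝒜 1) + c₂ 𝒜`. -/
def Smat (ω w c₁ c₂ : ℝ) (𝒜 : Matrix (Fin n) (Fin n) ℝ) : Matrix (Fin n) (Fin n) ℝ :=
  (ω / w) • (1 : Matrix (Fin n) (Fin n) ℝ)
    + c₁ • Matrix.diagonal (fun i => ∑ j, 𝒜 i j) + c₂ • 𝒜

/-- `diag(𝒜 1)` : the diagonal matrix of row sums. -/
def rowSumDiag (𝒜 : Matrix (Fin n) (Fin n) ℝ) : Matrix (Fin n) (Fin n) ℝ :=
  Matrix.diagonal (fun i => ∑ j, 𝒜 i j)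

/-- `diag(1ᵀ M)` : the diagonal matrix of column sums. -/
def colSumDiag (M : Matrix (Fin n) (Fin n) ℝ) : Matrix (Fin n) (Fin n) ℝ :=
  Matrix.diagonal (fun j => ∑ i, M i j)

/-- the operator (spectral) norm of a matrix, viewed as a linear map between
Euclidean spaces. -/
def matOpNorm {ι κ : Type*} [Fintype ι] [Fintype κ] [DecidableEq ι] (M : Matrix κ ι ℝ) : ℝ :=
  ‖LinearMap.toContinuousLinearMap (Matrix.toEuclideanLin M)‖


/-- the symmetrically-normalized adjacency matrix `A_sym := D^{-1/2} A D^{-1/2}`. -/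
def Asym (G : SimpleGraph (Fin n)) [DecidableRel G.Adj] : Matrix (Fin n) (Fin n) ℝ :=
  Matrix.diagonal (fun a => (Real.sqrt (G.degree a))⁻¹) * G.adjMatrix ℝ *
    Matrix.diagonal (fun a => (Real.sqrt (G.degree a))⁻¹)

/-- the random-walk normalized adjacency matrix `D^{-1} A`. -/
def Arw (G : SimpleGraph (Fin n)) [DecidableRel G.Adj] : Matrix (Fin n) (Fin n) ℝ :=
  Matrix.diagonal (fun a => ((G.degree a : ℝ))⁻¹) * G.adjMatrix ℝ
/-- the normalized graph Laplacian `Δ := I - A_sym`. -/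
def nLap (G : SimpleGraph (Fin n)) [DecidableRel G.Adj] : Matrix (Fin n) (Fin n) ℝ :=
  1 - Asym G

/-- the matrix `Z := I - c₂ Δ`. -/
def Zmat (c₂ : ℝ) (G : SimpleGraph (Fin n)) [DecidableRel G.Adj] : Matrix (Fin n) (Fin n) ℝ :=
  1 - c₂ • nLap G

/-- the commute time `τ(v,u) = 2|E| Σ_{ℓ≥1} (1/λ_ℓ)(φ_ℓ(v)/√d_v - φ_ℓ(u)/√d_u)²`,
expressed spectrally. -/
def commuteTime (G : SimpleGraph (Fin n)) [DecidableRel G.Adj]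
    (lam : Fin n → ℝ) (φ : Fin n → Fin n → ℝ) (v u : Fin n) : ℝ :=
  2 * (G.edgeFinset.card : ℝ) *
    ∑ ℓ ∈ Finset.univ.filter (fun ℓ : Fin n => (ℓ : ℕ) ≠ 0),
      (1 / lam ℓ) *
        (φ ℓ v / Real.sqrt (G.degree v) - φ ℓ u / Real.sqrt (G.degree u)) ^ 2

/-- the pseudo-inverse `Δ† := Σ_{ℓ≥1} (1/λ_ℓ) φ_ℓ φ_ℓᵀ` of the normalized Laplacian. -/
def nLapPinv (lam : Fin n → ℝ) (φ : Fin n → Fin n → ℝ) : Matrix (Fin n) (Fin n) ℝ :=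
  Matrix.of fun a b =>
    ∑ ℓ ∈ Finset.univ.filter (fun ℓ : Fin n => (ℓ : ℕ) ≠ 0), (1 / lam ℓ) * (φ ℓ a * φ ℓ b)

/-- second-order chain rule along two directions. -/
theorem comp2 {E F G : Type*} [NormedAddCommGroup E] [NormedSpace ℝ E]
    [NormedAddCommGroup F] [NormedSpace ℝ F] [NormedAddCommGroup G] [NormedSpace ℝ G]
    {f : E → F} {g : F → G} (hf : ContDiff ℝ 2 f) (hg : ContDiff ℝ 2 g) (Y e1 e2 : E) :
    fderiv ℝ (fun Z => fderiv ℝ (fun x => g (f x)) Z e1) Y e2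
      = (fderiv ℝ (fderiv ℝ g) (f Y) (fderiv ℝ f Y e2)) (fderiv ℝ f Y e1)
        + fderiv ℝ g (f Y) (fderiv ℝ (fun Z => fderiv ℝ f Z e1) Y e2) := by
  have hfd : Differentiable ℝ f := hf.differentiable (by norm_num)
  have hgd : Differentiable ℝ g := hg.differentiable (by norm_num)
  have hf1 : Differentiable ℝ (fderiv ℝ f) :=
    (hf.fderiv_right (m := 1) (by norm_num)).differentiable (by norm_num)
  have hg1 : Differentiable ℝ (fderiv ℝ g) :=
    (hg.fderiv_right (m := 1) (by norm_num)).differentiable (by norm_num)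
  have h1 : (fun Z => fderiv ℝ (fun x => g (f x)) Z e1)
      = fun Z => fderiv ℝ g (f Z) (fderiv ℝ f Z e1) := by
    funext Z
    have := fderiv_comp (𝕜 := ℝ) Z (hgd (f Z)) (hfd Z)
    have h2 : (fun x => g (f x)) = g ∘ f := rfl
    rw [h2, this]; rfl
  rw [h1]
  have hA : HasFDerivAt (fun Z => fderiv ℝ g (f Z))
      ((fderiv ℝ (fderiv ℝ g) (f Y)).comp (fderiv ℝ f Y)) Y :=
    (hg1 (f Y)).hasFDerivAt.comp Y (hfd Y).hasFDerivAt
  have hB : HasFDerivAt (fun Z => fderiv ℝ f Z e1)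
      (fderiv ℝ (fun Z => fderiv ℝ f Z e1) Y) Y :=
    (((hf1 Y).clm_apply (differentiableAt_const e1))).hasFDerivAt
  rw [(hA.clm_apply hB).fderiv]
  simp [add_comm]

/-- bounds for directional derivatives up to order two. -/
def Bd {E V : Type*} [NormedAddCommGroup E] [NormedSpace ℝ E]
    [NormedAddCommGroup V] [NormedSpace ℝ V] (e1 e2 : E) (f : E → V) (b a H : ℝ) : Prop :=
  ContDiff ℝ 2 f ∧ ∀ Y, ‖fderiv ℝ f Y e1‖ ≤ b ∧ ‖fderiv ℝ f Y e2‖ ≤ a ∧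
    ‖fderiv ℝ (fun Z => fderiv ℝ f Z e1) Y e2‖ ≤ H

section BdLemmas

variable {E V V' : Type*} [NormedAddCommGroup E] [NormedSpace ℝ E]
    [NormedAddCommGroup V] [NormedSpace ℝ V] [NormedAddCommGroup V'] [NormedSpace ℝ V']
    {e1 e2 : E}

theorem dd_diff {f : E → V} (hf : ContDiff ℝ 2 f) (e1 : E) :
    Differentiable ℝ (fun Z => fderiv ℝ f Z e1) := by
  have hf1 : Differentiable ℝ (fderiv ℝ f) :=
    (hf.fderiv_right (m := 1) (by norm_num)).differentiable (by norm_num)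
  exact fun Y => (hf1 Y).clm_apply (differentiableAt_const e1)

theorem Bd.clm {f : E → V} {b a H l : ℝ} (h : Bd e1 e2 f b a H) (L : V →L[ℝ] V') (hL : ‖L‖ ≤ l) :
    Bd e1 e2 (fun Y => L (f Y)) (l * b) (l * a) (l * H) := by
  obtain ⟨hf, hb⟩ := h
  have hfd : Differentiable ℝ f := hf.differentiable (by norm_num)
  have key : ∀ x : V, ∀ c : ℝ, ‖x‖ ≤ c → ‖L x‖ ≤ l * c := fun x c hx =>
    (L.le_opNorm x).trans (mul_le_mul hL hx (norm_nonneg _) ((norm_nonneg _).trans hL))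
  have h1 : ∀ Y e, fderiv ℝ (fun Y => L (f Y)) Y e = L (fderiv ℝ f Y e) := by
    intro Y e
    have : HasFDerivAt (fun Y => L (f Y)) (L.comp (fderiv ℝ f Y)) Y :=
      L.hasFDerivAt.comp Y (hfd Y).hasFDerivAt
    rw [this.fderiv]; rfl
  refine ⟨L.contDiff.comp hf, fun Y => ⟨?_, ?_, ?_⟩⟩
  · rw [h1]; exact key _ _ (hb Y).1
  · rw [h1]; exact key _ _ (hb Y).2.1
  · have h2 : (fun Z => fderiv ℝ (fun Y => L (f Y)) Z e1) = fun Z => L (fderiv ℝ f Z e1) := by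
      funext Z; exact h1 Z e1
    have : HasFDerivAt (fun Y => L (fderiv ℝ f Y e1))
        (L.comp (fderiv ℝ (fun Z => fderiv ℝ f Z e1) Y)) Y :=
      L.hasFDerivAt.comp Y (dd_diff hf e1 Y).hasFDerivAt
    rw [h2, this.fderiv]; exact key _ _ (hb Y).2.2

theorem Bd.add {f g : E → V} {b a H b' a' H' : ℝ} (h : Bd e1 e2 f b a H)
    (h' : Bd e1 e2 g b' a' H') :
    Bd e1 e2 (fun Y => f Y + g Y) (b + b') (a + a') (H + H') := by
  obtain ⟨hf, hb⟩ := h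
  obtain ⟨hg, hb'⟩ := h'
  have hfd : Differentiable ℝ f := hf.differentiable (by norm_num)
  have hgd : Differentiable ℝ g := hg.differentiable (by norm_num)
  have h1 : ∀ Y e, fderiv ℝ (fun Y => f Y + g Y) Y e = fderiv ℝ f Y e + fderiv ℝ g Y e := by
    intro Y e
    rw [fderiv_fun_add (hfd Y) (hgd Y)]
    rfl
  refine ⟨hf.add hg, fun Y => ⟨?_, ?_, ?_⟩⟩
  · rw [h1]; exact norm_add_le_of_le (hb Y).1 (hb' Y).1
  · rw [h1]; exact norm_add_le_of_le (hb Y).2.1 (hb' Y).2.1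
  · have h2 : (fun Z => fderiv ℝ (fun Y => f Y + g Y) Z e1)
        = fun Z => fderiv ℝ f Z e1 + fderiv ℝ g Z e1 := by
      funext Z; exact h1 Z e1
    rw [h2, fderiv_fun_add (dd_diff hf e1 Y) (dd_diff hg e1 Y)]
    exact norm_add_le_of_le (hb Y).2.2 (hb' Y).2.2

theorem Bd.zero : Bd e1 e2 (fun _ : E => (0 : V)) 0 0 0 := by
  refine ⟨contDiff_const, fun Y => ?_⟩
  simp

theorem Bd.sum {ι : Type*} (s : Finset ι) {f : ι → E → V} {b a H : ι → ℝ}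
    (h : ∀ i, Bd e1 e2 (f i) (b i) (a i) (H i)) :
    Bd e1 e2 (fun Y => ∑ i ∈ s, f i Y) (∑ i ∈ s, b i) (∑ i ∈ s, a i) (∑ i ∈ s, H i) := by
  classical
  induction s using Finset.induction_on with
  | empty => simpa using Bd.zero
  | insert i s hi ih =>
    simp only [Finset.sum_insert hi]
    exact (h i).add ih

theorem Bd.mono {f : E → V} {b a H b' a' H' : ℝ} (h : Bd e1 e2 f b a H)
    (hb : b ≤ b') (ha : a ≤ a') (hH : H ≤ H') : Bd e1 e2 f b' a' H' :=
  ⟨h.1, fun Y => ⟨(h.2 Y).1.trans hb, (h.2 Y).2.1.trans ha, (h.2 Y).2.2.trans hH⟩⟩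

theorem Bd.psi {f g : E → V} {b a H b' a' H' c₁ c₂ c2 : ℝ} (h : Bd e1 e2 f b a H)
    (h' : Bd e1 e2 g b' a' H') {ψ : V × V → V} (hψ : ContDiff ℝ 2 ψ)
    (hψ₁ : ∀ x y, ‖fderiv ℝ (fun z => ψ (z, y)) x‖ ≤ c₁)
    (hψ₂ : ∀ x y, ‖fderiv ℝ (fun z => ψ (x, z)) y‖ ≤ c₂)
    (hψ₃ : ∀ p, ‖iteratedFDeriv ℝ 2 ψ p‖ ≤ c2) :
    Bd e1 e2 (fun Y => ψ (f Y, g Y)) (c₁ * b + c₂ * b') (c₁ * a + c₂ * a')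
      (c₁ * H + c₂ * H' + c2 * ((a + a') * (b + b'))) := by
  obtain ⟨hf, hb⟩ := h
  obtain ⟨hg, hb'⟩ := h'
  have hfd : Differentiable ℝ f := hf.differentiable (by norm_num)
  have hgd : Differentiable ℝ g := hg.differentiable (by norm_num)
  have hψd : Differentiable ℝ ψ := hψ.differentiable (by norm_num)
  have hc1 : 0 ≤ c₁ := (norm_nonneg _).trans (hψ₁ 0 0)
  have hc2 : 0 ≤ c₂ := (norm_nonneg _).trans (hψ₂ 0 0)
  have hc3 : 0 ≤ c2 := (norm_nonneg _).trans (hψ₃ 0)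
  have hp : ∀ p x y, fderiv ℝ ψ p (x, y)
      = fderiv ℝ (fun z => ψ (z, p.2)) p.1 x + fderiv ℝ (fun z => ψ (p.1, z)) p.2 y := by
    intro p x y
    have e1 : HasFDerivAt (fun z => ψ (z, p.2)) ((fderiv ℝ ψ p).comp (ContinuousLinearMap.inl ℝ V V)) p.1 :=
      (hψd (p.1, p.2)).hasFDerivAt.comp p.1 (hasFDerivAt_prodMk_left p.1 p.2)
    have e2 : HasFDerivAt (fun z => ψ (p.1, z)) ((fderiv ℝ ψ p).comp (ContinuousLinearMap.inr ℝ V V)) p.2 :=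
      (hψd (p.1, p.2)).hasFDerivAt.comp p.2 (hasFDerivAt_prodMk_right p.1 p.2)
    rw [e1.fderiv, e2.fderiv]
    simp [← map_add]
  have hpb : ∀ p x y X Y, ‖x‖ ≤ X → ‖y‖ ≤ Y → ‖fderiv ℝ ψ p (x, y)‖ ≤ c₁ * X + c₂ * Y := by
    intro p x y X Y hx hy
    rw [hp]
    refine norm_add_le_of_le ?_ ?_
    · exact (ContinuousLinearMap.le_opNorm _ x).trans (mul_le_mul (hψ₁ _ _) hx (norm_nonneg _) hc1)
    · exact (ContinuousLinearMap.le_opNorm _ y).trans (mul_le_mul (hψ₂ _ _) hy (norm_nonneg _) hc2)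
  have hpair : ContDiff ℝ 2 (fun Y => (f Y, g Y)) := hf.prodMk hg
  have hpd : ∀ Y e, fderiv ℝ (fun Y => (f Y, g Y)) Y e = (fderiv ℝ f Y e, fderiv ℝ g Y e) := by
    intro Y e
    rw [((hfd Y).hasFDerivAt.prodMk (hgd Y).hasFDerivAt).fderiv]; rfl
  have h1 : ∀ Y e, fderiv ℝ (fun Y => ψ (f Y, g Y)) Y e
      = fderiv ℝ ψ (f Y, g Y) (fderiv ℝ f Y e, fderiv ℝ g Y e) := by
    intro Y e
    have : HasFDerivAt (fun Y => ψ (f Y, g Y)) _ Y :=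
      (hψd (f Y, g Y)).hasFDerivAt.comp Y ((hfd Y).hasFDerivAt.prodMk (hgd Y).hasFDerivAt)
    rw [this.fderiv]; rfl
  refine ⟨hψ.comp hpair, fun Y => ⟨?_, ?_, ?_⟩⟩
  · rw [h1]; exact hpb _ _ _ _ _ (hb Y).1 (hb' Y).1
  · rw [h1]; exact hpb _ _ _ _ _ (hb Y).2.1 (hb' Y).2.1
  · have := comp2 hpair hψ Y e1 e2
    rw [this, add_comm (c₁ * H + c₂ * H')]
    refine norm_add_le_of_le ?_ ?_
    · rw [hpd, hpd]
      have h3 : (fderiv ℝ (fderiv ℝ ψ) (f Y, g Y) (fderiv ℝ f Y e2, fderiv ℝ g Y e2))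
          (fderiv ℝ f Y e1, fderiv ℝ g Y e1)
          = iteratedFDeriv ℝ 2 ψ (f Y, g Y)
            ![(fderiv ℝ f Y e2, fderiv ℝ g Y e2), (fderiv ℝ f Y e1, fderiv ℝ g Y e1)] := by
        rw [iteratedFDeriv_two_apply]; rfl
      have hpn : ∀ x y : V, ∀ X Y : ℝ, ‖x‖ ≤ X → ‖y‖ ≤ Y → ‖(x, y)‖ ≤ X + Y := by
        intro x y X Y hx hy
        rw [Prod.norm_def]
        exact max_le (by linarith [norm_nonneg y]) (by linarith [norm_nonneg x])
      rw [h3]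
      refine (ContinuousMultilinearMap.le_opNorm _ _).trans ?_
      rw [Fin.prod_univ_two]
      have n1 := hpn _ _ _ _ (hb Y).2.1 (hb' Y).2.1
      have n2 := hpn _ _ _ _ (hb Y).1 (hb' Y).1
      refine mul_le_mul (hψ₃ _) ?_ (by positivity) hc3
      exact mul_le_mul n1 n2 (norm_nonneg _) ((norm_nonneg _).trans n1)
    · have h2 : (fun Z => fderiv ℝ (fun Y => (f Y, g Y)) Z e1)
          = fun Z => (fderiv ℝ f Z e1, fderiv ℝ g Z e1) := by
        funext Z; exact hpd Z e1
      rw [h2, ((dd_diff hf e1 Y).hasFDerivAt.prodMk (dd_diff hg e1 Y).hasFDerivAt).fderiv]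
      exact hpb _ _ _ _ _ (hb Y).2.2 (hb' Y).2.2

end BdLemmas

theorem norm_had_le (p : Fin d → ℝ) (hp : ∀ i, |p i| ≤ 1) (x : EuclideanSpace ℝ (Fin d)) :
    ‖(WithLp.toLp 2 (fun i => p i * x i) : EuclideanSpace ℝ (Fin d))‖ ≤ ‖x‖ := by
  rw [EuclideanSpace.norm_eq, EuclideanSpace.norm_eq]
  refine Real.sqrt_le_sqrt (Finset.sum_le_sum fun i _ => ?_)
  simp only [norm_mul, Real.norm_eq_abs]
  have : |p i| * |x i| ≤ |x i| := mul_le_of_le_one_left (abs_nonneg _) (hp i)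
  exact pow_le_pow_left₀ (by positivity) this 2

theorem Bd.act {E : Type*} [NormedAddCommGroup E] [NormedSpace ℝ E] {e1 e2 : E}
    {f : E → EuclideanSpace ℝ (Fin d)} {b a H : ℝ} (h : Bd e1 e2 f b a H)
    {σ : ℝ → ℝ} (hσ : ContDiff ℝ 2 σ)
    (hσ' : ∀ x, |deriv σ x| ≤ 1) (hσ'' : ∀ x, |deriv (deriv σ) x| ≤ 1) :
    Bd e1 e2 (fun Y => OSQ.act σ (f Y)) b a (H + a * b) := by
  obtain ⟨hf, hb⟩ := h
  have hfd : Differentiable ℝ f := hf.differentiable (by norm_num)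
  have hσd : Differentiable ℝ σ := hσ.differentiable (by norm_num)
  have hσ1 : ContDiff ℝ 1 (deriv σ) := by
    have h2 : ContDiff ℝ (1 + 1) σ := by
      have : (1 + 1 : WithTop ℕ∞) = 2 := by norm_num
      rw [this]; exact hσ
    exact (contDiff_succ_iff_deriv.1 h2).2.2
  have hσ1d : Differentiable ℝ (deriv σ) := hσ1.differentiable (by norm_num)
  have hcf : ∀ i, ContDiff ℝ 2 (fun Y => f Y i) := fun i =>
    (EuclideanSpace.proj (𝕜 := ℝ) i : EuclideanSpace ℝ (Fin d) →L[ℝ] ℝ).contDiff.comp hf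
  have hCD : ContDiff ℝ 2 (fun Y => OSQ.act σ (f Y)) := by
    rw [contDiff_euclidean]
    intro i
    exact hσ.comp (hcf i)
  have hd : ∀ {g : E → EuclideanSpace ℝ (Fin d)} {Y : E}, DifferentiableAt ℝ g Y → ∀ i,
      HasFDerivAt (fun Y => g Y i) ((EuclideanSpace.proj (𝕜 := ℝ) i).comp (fderiv ℝ g Y)) Y := by
    intro g Y hg i
    exact (EuclideanSpace.proj (𝕜 := ℝ) i :
      EuclideanSpace ℝ (Fin d) →L[ℝ] ℝ).hasFDerivAt.comp Y hg.hasFDerivAt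
  have hAd : Differentiable ℝ (fun Y => OSQ.act σ (f Y)) := hCD.differentiable (by norm_num)
  have h1i : ∀ Y e i, fderiv ℝ (fun Y => OSQ.act σ (f Y)) Y e i
      = deriv σ (f Y i) * fderiv ℝ f Y e i := by
    intro Y e i
    have A1 := (hd (hAd Y) i).fderiv
    have A2 : HasFDerivAt (fun Y => σ (f Y i)) _ Y :=
      (hσd (f Y i)).hasDerivAt.comp_hasFDerivAt Y (hd (hfd Y) i)
    have A3 : (fun Y => OSQ.act σ (f Y) i) = fun Y => σ (f Y i) := rfl
    rw [A3, A2.fderiv] at A1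
    have := congrArg (fun L => L e) A1
    simpa using this.symm
  have h1 : ∀ Y e, fderiv ℝ (fun Y => OSQ.act σ (f Y)) Y e
      = WithLp.toLp 2 (fun i => deriv σ (f Y i) * fderiv ℝ f Y e i) := by
    intro Y e
    ext i
    exact h1i Y e i
  have h2 : ∀ Y, fderiv ℝ (fun Z => fderiv ℝ (fun Y => OSQ.act σ (f Y)) Z e1) Y e2
      = WithLp.toLp 2 (fun i => deriv σ (f Y i) * fderiv ℝ (fun Z => fderiv ℝ f Z e1) Y e2 i)
       + WithLp.toLp 2 (fun i => deriv (deriv σ) (f Y i) *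
          (WithLp.toLp 2 (fun i => fderiv ℝ f Y e2 i * fderiv ℝ f Y e1 i) :
            EuclideanSpace ℝ (Fin d)) i) := by
    intro Y
    ext i
    have A1 := (hd (dd_diff hCD e1 Y) i).fderiv
    have A2 : HasFDerivAt (fun Y => deriv σ (f Y i))
        (deriv (deriv σ) (f Y i) • (EuclideanSpace.proj (𝕜 := ℝ) i).comp (fderiv ℝ f Y)) Y :=
      HasDerivAt.comp_hasFDerivAt (h₂ := deriv σ) Y (hσ1d (f Y i)).hasDerivAt (hd (hfd Y) i)
    have A3 : (fun Z => fderiv ℝ (fun Y => OSQ.act σ (f Y)) Z e1 i)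
        = fun Z => deriv σ (f Z i) * fderiv ℝ f Z e1 i := by
      funext Z; exact h1i Z e1 i
    have A4 : HasFDerivAt (fun Z => deriv σ (f Z i) * fderiv ℝ f Z e1 i) _ Y :=
      A2.mul (hd (dd_diff hf e1 Y) i)
    rw [A3, A4.fderiv] at A1
    have := congrArg (fun L => L e2) A1
    refine Eq.trans this.symm ?_
    change deriv σ (f Y i) * (fderiv ℝ (fun Z => fderiv ℝ f Z e1) Y e2 i)
      + fderiv ℝ f Y e1 i * (deriv (deriv σ) (f Y i) * fderiv ℝ f Y e2 i)
      = deriv σ (f Y i) * (fderiv ℝ (fun Z => fderiv ℝ f Z e1) Y e2 i)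
      + deriv (deriv σ) (f Y i) * (fderiv ℝ f Y e2 i * fderiv ℝ f Y e1 i)
    ring
  refine ⟨hCD, fun Y => ⟨?_, ?_, ?_⟩⟩
  · rw [h1]; exact (norm_had_le _ (fun i => hσ' _) _).trans (hb Y).1
  · rw [h1]; exact (norm_had_le _ (fun i => hσ' _) _).trans (hb Y).2.1
  · rw [h2]
    refine norm_add_le_of_le ((norm_had_le _ (fun i => hσ' _) _).trans (hb Y).2.2) ?_
    refine (norm_had_le _ (fun i => hσ'' _) _).trans ?_
    have hle : ‖(WithLp.toLp 2 (fun i => fderiv ℝ f Y e2 i * fderiv ℝ f Y e1 i) :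
            EuclideanSpace ℝ (Fin d))‖ ≤ ‖fderiv ℝ f Y e2‖ * ‖fderiv ℝ f Y e1‖ := by
      rw [EuclideanSpace.norm_eq, EuclideanSpace.norm_eq (fderiv ℝ f Y e1)]
      have : ‖fderiv ℝ f Y e2‖ = √(‖fderiv ℝ f Y e2‖ ^ 2) := by
        rw [Real.sqrt_sq (norm_nonneg _)]
      rw [this, ← Real.sqrt_mul (by positivity), Finset.mul_sum]
      refine Real.sqrt_le_sqrt (Finset.sum_le_sum fun i _ => ?_)
      simp only [norm_mul, mul_pow]
      gcongr
      exact PiLp.norm_apply_le _ i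
    refine hle.trans (mul_le_mul (hb Y).2.1 (hb Y).1 (norm_nonneg _)
      ((norm_nonneg _).trans (hb Y).2.1))

/-- recursive bound on the Hessian of the node features. -/
def Hb (c c2 : ℝ) (𝒜 : Matrix (Fin n) (Fin n) ℝ) (a b : ℕ → Fin n → ℝ) : ℕ → Fin n → ℝ
  | 0, _ => 0
  | (t+1), i => (1 - c) * Hb c c2 𝒜 a b t i + c * ∑ j, 𝒜 i j * Hb c c2 𝒜 a b t j
      + c2 * ∑ j, 𝒜 i j * ((a t i + a t j) * (b t i + b t j)) + a (t+1) i * b (t+1) i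

theorem mpnn_bd (𝒜 : Matrix (Fin n) (Fin n) ℝ) (h𝒜 : ∀ i j, 0 ≤ 𝒜 i j) (h𝒜1 : ∀ i, ∑ j, 𝒜 i j = 1)
    (σ : ℝ → ℝ) (hσ : ContDiff ℝ 2 σ)
    (hσ' : ∀ x, |deriv σ x| ≤ 1) (hσ'' : ∀ x, |deriv (deriv σ) x| ≤ 1)
    (Ω W : ℕ → EuclideanSpace ℝ (Fin d) →L[ℝ] EuclideanSpace ℝ (Fin d))
    (ω w : ℝ) (hw : 0 < w) (hΩ : ∀ t, ‖Ω t‖ ≤ ω) (hW : ∀ t, ‖W t‖ ≤ w)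
    (ψ : ℕ → EuclideanSpace ℝ (Fin d) × EuclideanSpace ℝ (Fin d) → EuclideanSpace ℝ (Fin d))
    (hψ : ∀ t, ContDiff ℝ 2 (ψ t)) (c₁ c₂ c2 : ℝ)
    (hψ₁ : ∀ t x y, ‖fderiv ℝ (fun z => ψ t (z, y)) x‖ ≤ c₁)
    (hψ₂ : ∀ t x y, ‖fderiv ℝ (fun z => ψ t (x, z)) y‖ ≤ c₂)
    (hψ₃ : ∀ t p, ‖iteratedFDeriv ℝ 2 (ψ t) p‖ ≤ c2)
    (hw1 : w ≤ 1) (hcap : ω / w + c₁ + c₂ ≤ 1)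
    (e1 e2 : Fin n → EuclideanSpace ℝ (Fin d)) (a b : ℕ → Fin n → ℝ)
    (ha0 : ∀ i, ‖e2 i‖ ≤ a 0 i) (hb0 : ∀ i, ‖e1 i‖ ≤ b 0 i)
    (ha : ∀ t i, a (t+1) i = (1 - c₂) * a t i + c₂ * ∑ j, 𝒜 i j * a t j)
    (hb : ∀ t i, b (t+1) i = (1 - c₂) * b t i + c₂ * ∑ j, 𝒜 i j * b t j) (t : ℕ) :
    ∀ i, Bd e1 e2 (fun Y => mpnn σ 𝒜 Ω W ψ t Y i) (b t i) (a t i) (Hb c₂ c2 𝒜 a b t i) := by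
  have hc1 : 0 ≤ c₁ := (norm_nonneg _).trans (hψ₁ 0 0 0)
  have hc2 : 0 ≤ c₂ := (norm_nonneg _).trans (hψ₂ 0 0 0)
  have hc3 : 0 ≤ c2 := (norm_nonneg _).trans (hψ₃ 0 0)
  have hωw : ω + w * c₁ ≤ w * (1 - c₂) := by
    have : ω = w * (ω / w) := by field_simp
    rw [this, ← mul_add]
    exact mul_le_mul_of_nonneg_left (by linarith) hw.le
  induction t with
  | zero =>
    intro i
    have h1 : ∀ Y e, fderiv ℝ (fun Y : Fin n → EuclideanSpace ℝ (Fin d) => Y i) Y e = e i := by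
      intro Y e
      rw [(hasFDerivAt_apply i Y).fderiv]; rfl
    refine ⟨contDiff_apply ℝ _ i, fun Y => ⟨?_, ?_, ?_⟩⟩
    · simp only [mpnn]; rw [h1]; exact hb0 i
    · simp only [mpnn]; rw [h1]; exact ha0 i
    · simp only [mpnn, h1]; simp [Hb]
  | succ t ih =>
    intro i
    have hx0 : ∀ j, 0 ≤ b t j ∧ 0 ≤ a t j ∧ 0 ≤ Hb c₂ c2 𝒜 a b t j := fun j =>
      ⟨(norm_nonneg _).trans ((ih j).2 0).1, (norm_nonneg _).trans ((ih j).2 0).2.1,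
        (norm_nonneg _).trans ((ih j).2 0).2.2⟩
    -- one-step comparison
    have key : ∀ x : Fin n → ℝ, (∀ j, 0 ≤ x j) → ∀ q : Fin n → ℝ, (∀ j, 0 ≤ q j) →
        ω * x i + w * ∑ j, 𝒜 i j * (c₁ * x i + c₂ * x j + q j)
          ≤ (1 - c₂) * x i + c₂ * ∑ j, 𝒜 i j * x j + ∑ j, 𝒜 i j * q j := by
      intro x hx q hq
      have e1 : ∑ j, 𝒜 i j * (c₁ * x i + c₂ * x j + q j)
          = c₁ * x i + c₂ * ∑ j, 𝒜 i j * x j + ∑ j, 𝒜 i j * q j := by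
        have : ∀ j, 𝒜 i j * (c₁ * x i + c₂ * x j + q j)
          = 𝒜 i j * (c₁ * x i) + c₂ * (𝒜 i j * x j) + 𝒜 i j * q j := fun j => by ring
        simp only [this, Finset.sum_add_distrib]
        rw [← Finset.sum_mul, h𝒜1, one_mul, ← Finset.mul_sum]
      rw [e1]
      have s1 : 0 ≤ ∑ j, 𝒜 i j * x j := Finset.sum_nonneg fun j _ => mul_nonneg (h𝒜 i j) (hx j)
      have s2 : 0 ≤ ∑ j, 𝒜 i j * q j := Finset.sum_nonneg fun j _ => mul_nonneg (h𝒜 i j) (hq j)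
      have hω0 : 0 ≤ ω := (norm_nonneg _).trans (hΩ 0)
      have t0 : 0 ≤ 1 - c₂ := by
        have : 0 ≤ ω / w := by positivity
        linarith
      have t1 : (ω + w * c₁) * x i ≤ (1 - c₂) * x i :=
        mul_le_mul_of_nonneg_right (hωw.trans (mul_le_of_le_one_left t0 hw1)) (hx i)
      have t2 : w * (c₂ * ∑ j, 𝒜 i j * x j) ≤ c₂ * ∑ j, 𝒜 i j * x j :=
        mul_le_of_le_one_left (by positivity) hw1
      have t3 : w * (∑ j, 𝒜 i j * q j) ≤ ∑ j, 𝒜 i j * q j :=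
        mul_le_of_le_one_left s2 hw1
      nlinarith
    have hsum : Bd e1 e2 (fun Y => ∑ j : Fin n, 𝒜 i j • ψ (t+1)
        (mpnn σ 𝒜 Ω W ψ t Y i, mpnn σ 𝒜 Ω W ψ t Y j))
        (∑ j, 𝒜 i j * (c₁ * b t i + c₂ * b t j))
        (∑ j, 𝒜 i j * (c₁ * a t i + c₂ * a t j))
        (∑ j, 𝒜 i j * (c₁ * Hb c₂ c2 𝒜 a b t i + c₂ * Hb c₂ c2 𝒜 a b t j
          + c2 * ((a t i + a t j) * (b t i + b t j)))) := by
      refine Bd.sum (Finset.univ) (fun j => ?_)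
      have h0 := (ih i).psi (ih j) (hψ (t+1)) (hψ₁ (t+1)) (hψ₂ (t+1)) (hψ₃ (t+1))
      have hL : ‖𝒜 i j • ContinuousLinearMap.id ℝ (EuclideanSpace ℝ (Fin d))‖ ≤ 𝒜 i j := by
        rw [norm_smul, Real.norm_of_nonneg (h𝒜 i j)]
        exact mul_le_of_le_one_right (h𝒜 i j) ContinuousLinearMap.norm_id_le
      exact h0.clm _ hL
    have hpre := ((ih i).clm (Ω (t+1)) (hΩ (t+1))).add (hsum.clm (W (t+1)) (hW (t+1)))
    have k1 := key (b t) (fun j => (hx0 j).1) (fun _ => 0) (fun _ => le_rfl)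
    have k2 := key (a t) (fun j => (hx0 j).2.1) (fun _ => 0) (fun _ => le_rfl)
    have k3 := key (Hb c₂ c2 𝒜 a b t) (fun j => (hx0 j).2.2)
      (fun j => c2 * ((a t i + a t j) * (b t i + b t j)))
      (fun j => mul_nonneg hc3 (mul_nonneg (add_nonneg (hx0 i).2.1 (hx0 j).2.1)
        (add_nonneg (hx0 i).1 (hx0 j).1)))
    simp only [add_zero, mul_zero, Finset.sum_const_zero] at k1 k2
    have hpre' := hpre.mono (k1.trans (hb t i).ge) (k2.trans (ha t i).ge) k3
    have := hpre'.act hσ hσ' hσ''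
    refine this.mono le_rfl le_rfl ?_
    simp only [Hb]
    refine le_of_eq ?_
    have e3 : ∑ j, 𝒜 i j * (c2 * ((a t i + a t j) * (b t i + b t j)))
      = c2 * ∑ j, 𝒜 i j * ((a t i + a t j) * (b t i + b t j)) := by
      rw [Finset.mul_sum]
      exact Finset.sum_congr rfl fun j _ => by ring
    rw [e3]

theorem mix_le (θ : EuclideanSpace ℝ (Fin d)) (hθ : ‖θ‖ = 1) (σ : ℝ → ℝ)
    (𝒜 : Matrix (Fin n) (Fin n) ℝ)
    (Ω W : ℕ → EuclideanSpace ℝ (Fin d) →L[ℝ] EuclideanSpace ℝ (Fin d))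
    (ψ : ℕ → EuclideanSpace ℝ (Fin d) × EuclideanSpace ℝ (Fin d) → EuclideanSpace ℝ (Fin d))
    (m : ℕ) (v u : Fin n) (X : Fin n → EuclideanSpace ℝ (Fin d)) (α β : Fin d)
    (b a H : Fin n → ℝ)
    (h : ∀ i, Bd (dir u β) (dir v α) (fun Y => mpnn σ 𝒜 Ω W ψ m Y i) (b i) (a i) (H i)) :
    |mixEntry θ σ 𝒜 Ω W ψ m v u X α β| ≤ ∑ i, H i := by
  have h1 := (Bd.sum Finset.univ h).clm (innerSL ℝ θ) (l := 1) (by rw [innerSL_apply_norm, hθ])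
  have h2 := (h1.2 X).2.2
  rw [one_mul] at h2
  have h3 : (fun Y => innerSL ℝ θ (∑ i, mpnn σ 𝒜 Ω W ψ m Y i)) = readout θ σ 𝒜 Ω W ψ m := by
    funext Y
    simp only [readout, innerSL_apply_apply, PiLp.inner_apply]
    exact Finset.sum_congr rfl fun i _ => by simp [mul_comm]
  rw [h3] at h2
  exact h2

/-- the vector `(s_v / s_i) Σ_ℓ f_ℓ φ_ℓ(i) φ_ℓ(v)`. -/
def gv (φ : Fin n → Fin n → ℝ) (s : Fin n → ℝ) (f : Fin n → ℝ) (v i : Fin n) : ℝ :=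
  s v / s i * ∑ ℓ, f ℓ * (φ ℓ i * φ ℓ v)

theorem complete_of_orth (φ : Fin n → Fin n → ℝ)
    (horth : ∀ k l, ∑ a, φ k a * φ l a = if k = l then (1 : ℝ) else 0) (i j : Fin n) :
    ∑ ℓ, φ ℓ i * φ ℓ j = if i = j then (1 : ℝ) else 0 := by
  have h1 : (Matrix.of φ) * (Matrix.of φ).transpose = 1 := by
    ext k l
    simp [Matrix.mul_apply, horth, Matrix.one_apply]
  have h2 := mul_eq_one_comm.1 h1
  have h3 := congrFun (congrFun h2 i) j
  simpa [Matrix.mul_apply, Matrix.one_apply] using h3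

theorem gv_one (φ : Fin n → Fin n → ℝ) (s : Fin n → ℝ) (hs : ∀ i, 0 < s i)
    (horth : ∀ k l, ∑ a, φ k a * φ l a = if k = l then (1 : ℝ) else 0) (v i : Fin n) :
    gv φ s (fun _ => 1) v i = if i = v then 1 else 0 := by
  simp only [gv, one_mul, complete_of_orth φ horth]
  split_ifs with h
  · subst h; simp [(hs i).ne']
  · simp

theorem gv_A (φ : Fin n → Fin n → ℝ) (s lam : Fin n → ℝ) (𝒜 : Matrix (Fin n) (Fin n) ℝ)
    (heig : ∀ ℓ i, ∑ j, 𝒜 i j * (φ ℓ j / s j) = (1 - lam ℓ) * (φ ℓ i / s i))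
    (f : Fin n → ℝ) (v i : Fin n) :
    ∑ j, 𝒜 i j * gv φ s f v j = gv φ s (fun ℓ => f ℓ * (1 - lam ℓ)) v i := by
  have h1 : ∀ j, 𝒜 i j * gv φ s f v j = ∑ ℓ, s v * f ℓ * φ ℓ v * (𝒜 i j * (φ ℓ j / s j)) := by
    intro j
    rw [gv, Finset.mul_sum, Finset.mul_sum]
    exact Finset.sum_congr rfl fun ℓ _ => by ring
  simp only [h1]
  rw [Finset.sum_comm, gv, Finset.mul_sum]
  refine Finset.sum_congr rfl fun ℓ _ => ?_
  rw [← Finset.mul_sum, heig]; ring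

theorem gv_step (φ : Fin n → Fin n → ℝ) (s lam : Fin n → ℝ) (𝒜 : Matrix (Fin n) (Fin n) ℝ)
    (heig : ∀ ℓ i, ∑ j, 𝒜 i j * (φ ℓ j / s j) = (1 - lam ℓ) * (φ ℓ i / s i))
    (c : ℝ) (t : ℕ) (v i : Fin n) :
    gv φ s (fun ℓ => (1 - c * lam ℓ) ^ (t+1)) v i
      = (1 - c) * gv φ s (fun ℓ => (1 - c * lam ℓ) ^ t) v i
        + c * ∑ j, 𝒜 i j * gv φ s (fun ℓ => (1 - c * lam ℓ) ^ t) v j := by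
  rw [gv_A φ s lam 𝒜 heig]
  simp only [gv, Finset.mul_sum]
  rw [← Finset.sum_add_distrib]
  exact Finset.sum_congr rfl fun ℓ _ => by ring

theorem gv_inner (φ : Fin n → Fin n → ℝ) (s : Fin n → ℝ) (hs : ∀ i, 0 < s i)
    (horth : ∀ k l, ∑ a, φ k a * φ l a = if k = l then (1 : ℝ) else 0)
    (f g : Fin n → ℝ) (v u : Fin n) :
    ∑ i, s i ^ 2 * (gv φ s f v i * gv φ s g u i)
      = s v * s u * ∑ ℓ, f ℓ * g ℓ * (φ ℓ v * φ ℓ u) := by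
  have h1 : ∀ i, s i ^ 2 * (gv φ s f v i * gv φ s g u i)
      = ∑ k, ∑ l, (s v * s u * (f k * φ k v) * (g l * φ l u)) * (φ k i * φ l i) := by
    intro i
    have hsi := (hs i).ne'
    have : s i ^ 2 * (gv φ s f v i * gv φ s g u i)
      = s v * s u * ((∑ ℓ, f ℓ * (φ ℓ i * φ ℓ v)) * (∑ ℓ, g ℓ * (φ ℓ i * φ ℓ u))) := by
      simp only [gv]; field_simp
    rw [this, Finset.sum_mul_sum, Finset.mul_sum]
    refine Finset.sum_congr rfl fun k _ => ?_
    rw [Finset.mul_sum]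
    exact Finset.sum_congr rfl fun l _ => by ring
  simp only [h1]
  rw [Finset.sum_comm, Finset.mul_sum]
  refine Finset.sum_congr rfl fun k _ => ?_
  rw [Finset.sum_comm]
  simp only [← Finset.mul_sum, horth]
  simp
  ring

theorem K_formula (φ : Fin n → Fin n → ℝ) (s lam : Fin n → ℝ) (hs : ∀ i, 0 < s i)
    (horth : ∀ k l, ∑ a, φ k a * φ l a = if k = l then (1 : ℝ) else 0)
    (𝒜 : Matrix (Fin n) (Fin n) ℝ) (h𝒜1 : ∀ i, ∑ j, 𝒜 i j = 1)
    (hsym : ∀ i j, s i ^ 2 * 𝒜 i j = s j ^ 2 * 𝒜 j i)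
    (heig : ∀ ℓ i, ∑ j, 𝒜 i j * (φ ℓ j / s j) = (1 - lam ℓ) * (φ ℓ i / s i))
    (c c2 : ℝ) (v u : Fin n) (m : ℕ) :
    ∑ i, s i ^ 2 * Hb c c2 𝒜 (fun t i => gv φ s (fun ℓ => (1 - c * lam ℓ) ^ t) v i)
        (fun t i => gv φ s (fun ℓ => (1 - c * lam ℓ) ^ t) u i) m i
      = s v * s u * ∑ t ∈ Finset.range m,
        (∑ ℓ, (1 - c * lam ℓ) ^ (2 * t + 2) * (φ ℓ v * φ ℓ u)
          + 2 * c2 * (∑ ℓ, (1 - c * lam ℓ) ^ (2 * t) * (φ ℓ v * φ ℓ u)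
            + ∑ ℓ, (1 - c * lam ℓ) ^ (2 * t) * (1 - lam ℓ) * (φ ℓ v * φ ℓ u))) := by
  have hst : ∀ x : Fin n → ℝ, ∑ i, s i ^ 2 * ∑ j, 𝒜 i j * x j = ∑ j, s j ^ 2 * x j := by
    intro x
    simp only [Finset.mul_sum]
    rw [Finset.sum_comm]
    refine Finset.sum_congr rfl fun j _ => ?_
    have : ∀ i, s i ^ 2 * (𝒜 i j * x j) = 𝒜 j i * (s j ^ 2 * x j) := fun i => by
      rw [← mul_assoc, hsym]; ring
    simp only [this, ← Finset.sum_mul, h𝒜1, one_mul]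
  induction m with
  | zero => simp [Hb]
  | succ m ih =>
    set a : ℕ → Fin n → ℝ := fun t i => gv φ s (fun ℓ => (1 - c * lam ℓ) ^ t) v i with ha
    set b : ℕ → Fin n → ℝ := fun t i => gv φ s (fun ℓ => (1 - c * lam ℓ) ^ t) u i with hb
    rw [Finset.sum_range_succ, mul_add, ← ih]
    have e1 : ∑ i, s i ^ 2 * (a (m+1) i * b (m+1) i)
        = s v * s u * ∑ ℓ, (1 - c * lam ℓ) ^ (2 * m + 2) * (φ ℓ v * φ ℓ u) := by
      rw [ha, hb, gv_inner φ s hs horth]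
      congr 1
      exact Finset.sum_congr rfl fun ℓ _ => by ring
    have e2 : ∑ i, s i ^ 2 * (a m i * b m i)
        = s v * s u * ∑ ℓ, (1 - c * lam ℓ) ^ (2 * m) * (φ ℓ v * φ ℓ u) := by
      rw [ha, hb, gv_inner φ s hs horth]
      congr 1
      exact Finset.sum_congr rfl fun ℓ _ => by ring
    have e3 : ∑ i, s i ^ 2 * (a m i * ∑ j, 𝒜 i j * b m j)
        = s v * s u * ∑ ℓ, (1 - c * lam ℓ) ^ (2 * m) * (1 - lam ℓ) * (φ ℓ v * φ ℓ u) := by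
      simp only [ha, hb, gv_A φ s lam 𝒜 heig]
      rw [gv_inner φ s hs horth]
      congr 1
      exact Finset.sum_congr rfl fun ℓ _ => by ring
    have e4 : ∑ i, s i ^ 2 * ((∑ j, 𝒜 i j * a m j) * b m i)
        = s v * s u * ∑ ℓ, (1 - c * lam ℓ) ^ (2 * m) * (1 - lam ℓ) * (φ ℓ v * φ ℓ u) := by
      simp only [ha, hb, gv_A φ s lam 𝒜 heig]
      rw [gv_inner φ s hs horth]
      congr 1
      exact Finset.sum_congr rfl fun ℓ _ => by ring
    have e5 := hst (fun j => a m j * b m j)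
    have e6 := hst (fun j => Hb c c2 𝒜 a b m j)
    have q : ∀ i, ∑ j, 𝒜 i j * ((a m i + a m j) * (b m i + b m j))
        = a m i * b m i + a m i * (∑ j, 𝒜 i j * b m j) + (∑ j, 𝒜 i j * a m j) * b m i
          + ∑ j, 𝒜 i j * (a m j * b m j) := by
      intro i
      have : ∀ j, 𝒜 i j * ((a m i + a m j) * (b m i + b m j))
        = 𝒜 i j * (a m i * b m i) + a m i * (𝒜 i j * b m j) + (𝒜 i j * a m j) * b m i
          + 𝒜 i j * (a m j * b m j) := fun j => by ring
      simp only [this, Finset.sum_add_distrib]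
      rw [← Finset.sum_mul, h𝒜1, one_mul, ← Finset.mul_sum, ← Finset.sum_mul]
    have main : ∀ i, s i ^ 2 * Hb c c2 𝒜 a b (m+1) i
        = (1 - c) * (s i ^ 2 * Hb c c2 𝒜 a b m i)
          + c * (s i ^ 2 * ∑ j, 𝒜 i j * Hb c c2 𝒜 a b m j)
          + c2 * (s i ^ 2 * (a m i * b m i) + s i ^ 2 * (a m i * ∑ j, 𝒜 i j * b m j)
            + s i ^ 2 * ((∑ j, 𝒜 i j * a m j) * b m i)
            + s i ^ 2 * ∑ j, 𝒜 i j * (a m j * b m j))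
          + s i ^ 2 * (a (m+1) i * b (m+1) i) := by
      intro i
      simp only [Hb]
      rw [q i]
      ring
    simp only [main, Finset.sum_add_distrib, ← Finset.mul_sum]
    rw [e1, e3, e4, e5, e6, e2]
    ring

theorem gv_nonneg (φ : Fin n → Fin n → ℝ) (s lam : Fin n → ℝ) (hs : ∀ i, 0 < s i)
    (horth : ∀ k l, ∑ a, φ k a * φ l a = if k = l then (1 : ℝ) else 0)
    (𝒜 : Matrix (Fin n) (Fin n) ℝ) (h𝒜 : ∀ i j, 0 ≤ 𝒜 i j)
    (heig : ∀ ℓ i, ∑ j, 𝒜 i j * (φ ℓ j / s j) = (1 - lam ℓ) * (φ ℓ i / s i))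
    (c : ℝ) (hc0 : 0 ≤ c) (hc1 : c ≤ 1) (v : Fin n) (t : ℕ) :
    ∀ i, 0 ≤ gv φ s (fun ℓ => (1 - c * lam ℓ) ^ t) v i := by
  induction t with
  | zero =>
    intro i
    simp only [pow_zero]
    rw [gv_one φ s hs horth]
    split_ifs <;> norm_num
  | succ t ih =>
    intro i
    rw [gv_step φ s lam 𝒜 heig]
    have : 0 ≤ ∑ j, 𝒜 i j * gv φ s (fun ℓ => (1 - c * lam ℓ) ^ t) v j :=
      Finset.sum_nonneg fun j _ => mul_nonneg (h𝒜 i j) (ih j)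
    have h1 := ih i
    have h2 : 0 ≤ 1 - c := by linarith
    positivity

theorem gv_zero (G : SimpleGraph (Fin n)) (hconn : G.Connected)
    (φ : Fin n → Fin n → ℝ) (s lam : Fin n → ℝ) (hs : ∀ i, 0 < s i)
    (horth : ∀ k l, ∑ a, φ k a * φ l a = if k = l then (1 : ℝ) else 0)
    (𝒜 : Matrix (Fin n) (Fin n) ℝ) (h𝒜 : ∀ i j, ¬ G.Adj i j → 𝒜 i j = 0)
    (heig : ∀ ℓ i, ∑ j, 𝒜 i j * (φ ℓ j / s j) = (1 - lam ℓ) * (φ ℓ i / s i))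
    (c : ℝ) (v : Fin n) (t : ℕ) :
    ∀ i, t < G.dist v i → gv φ s (fun ℓ => (1 - c * lam ℓ) ^ t) v i = 0 := by
  induction t with
  | zero =>
    intro i hi
    simp only [pow_zero]
    rw [gv_one φ s hs horth, if_neg]
    rintro rfl
    simp at hi
  | succ t ih =>
    intro i hi
    rw [gv_step φ s lam 𝒜 heig, ih i (by omega), Finset.sum_eq_zero]
    · simp
    · intro j _
      by_cases hij : G.Adj i j
      · rw [ih j, mul_zero]
        have h1 := hconn.dist_triangle (u := v) (v := j) (w := i)
        have h2 : G.dist j i = 1 := SimpleGraph.dist_eq_one_iff_adj.2 hij.symm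
        omega
      · rw [h𝒜 i j hij, zero_mul]

theorem sum_range_two_mul (Z : ℕ → ℝ) (m : ℕ) :
    ∑ k ∈ Finset.range (2 * m), Z k = ∑ t ∈ Finset.range m, (Z (2 * t) + Z (2 * t + 1)) := by
  induction m with
  | zero => simp
  | succ m ih =>
    rw [Finset.sum_range_succ, ← ih, show 2 * (m + 1) = 2 * m + 1 + 1 by ring,
      Finset.sum_range_succ, Finset.sum_range_succ]
    ring

theorem sum_even_le (Z : ℕ → ℝ) (hZ : ∀ k, 0 ≤ Z k) (m : ℕ) :
    ∑ t ∈ Finset.range m, Z (2 * t + 2) ≤ ∑ k ∈ Finset.range (2 * m + 1), Z k := by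
  induction m with
  | zero => simpa using hZ 0
  | succ m ih =>
    rw [Finset.sum_range_succ, show 2 * (m + 1) + 1 = 2 * m + 1 + 1 + 1 by ring,
      Finset.sum_range_succ, Finset.sum_range_succ]
    have := hZ (2 * m + 1)
    have e : 2 * m + 1 + 1 = 2 * m + 2 := rfl
    rw [e]
    linarith

theorem alt_sum (z : ℝ) (h0 : 0 ≤ z) (h1 : z ≤ 1) (m : ℕ) :
    0 ≤ ∑ t ∈ Finset.range m, z ^ (2 * t) * (1 - z) ∧
    ∑ t ∈ Finset.range m, z ^ (2 * t) * (1 - z) ≤ 1 - z ^ (2 * m) := by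
  have h2 : 0 ≤ 1 - z := by linarith
  refine ⟨Finset.sum_nonneg fun t _ => by positivity, ?_⟩
  induction m with
  | zero => simp
  | succ m ih =>
    rw [Finset.sum_range_succ]
    have : z ^ (2 * (m + 1)) = z ^ (2 * m) * z ^ 2 := by ring
    rw [this]
    have h3 : 0 ≤ z ^ (2 * m) * ((1 - z) * z) := by positivity
    nlinarith

theorem tot_le (x y lam : Fin n → ℝ) (c c2 B : ℝ) (hc0 : 0 < c) (hc1 : c ≤ 1) (hc2 : 0 ≤ c2)
    (hl0 : ∀ ℓ, 0 ≤ lam ℓ) (hl2 : ∀ ℓ, lam ℓ ≤ 2)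
    (hx : ∑ ℓ, x ℓ * x ℓ = 1) (hy : ∑ ℓ, y ℓ * y ℓ = 1) (m : ℕ) (Z : ℕ → ℝ)
    (hZdef : ∀ k, Z k = ∑ ℓ, (1 - c * lam ℓ) ^ k * (x ℓ * y ℓ)) (hZ : ∀ k, 0 ≤ Z k)
    (hB1 : ∑ k ∈ Finset.range (2 * m), Z k ≤ B)
    (hB2 : ∑ k ∈ Finset.range (2 * m + 1), Z k ≤ B) :
    ∑ t ∈ Finset.range m, (Z (2 * t + 2) + 2 * c2 * (Z (2 * t)
      + ∑ ℓ, (1 - c * lam ℓ) ^ (2 * t) * (1 - lam ℓ) * (x ℓ * y ℓ)))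
      ≤ B + 2 * c2 * (2 * B + 1 / c) := by
  rw [Finset.sum_add_distrib, ← Finset.mul_sum]
  refine add_le_add ((sum_even_le Z hZ m).trans hB2)
    (mul_le_mul_of_nonneg_left ?_ (by linarith))
  have hW : ∀ t, c * ∑ ℓ, (1 - c * lam ℓ) ^ (2 * t) * (1 - lam ℓ) * (x ℓ * y ℓ)
      = Z (2 * t + 1) - (1 - c) * Z (2 * t) := by
    intro t
    rw [hZdef, hZdef, Finset.mul_sum, Finset.mul_sum, ← Finset.sum_sub_distrib]
    exact Finset.sum_congr rfl fun ℓ _ => by ring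
  have hB0 : 0 ≤ B := (Finset.sum_nonneg fun k _ => hZ k).trans hB1
  rw [sum_range_two_mul] at hB1
  have hmul : c * ∑ t ∈ Finset.range m, (Z (2 * t)
      + ∑ ℓ, (1 - c * lam ℓ) ^ (2 * t) * (1 - lam ℓ) * (x ℓ * y ℓ))
      = ∑ t ∈ Finset.range m, (Z (2 * t + 1) + (2 * c - 1) * Z (2 * t)) := by
    rw [Finset.mul_sum]
    exact Finset.sum_congr rfl fun t _ => by rw [mul_add, hW]; ring
  suffices h : ∑ t ∈ Finset.range m, (Z (2 * t + 1) + (2 * c - 1) * Z (2 * t)) ≤ 2 * c * B + 1 by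
    rw [← hmul] at h
    have : c * (2 * B + 1 / c) = 2 * c * B + 1 := by field_simp
    rw [← this] at h
    exact le_of_mul_le_mul_left h hc0
  rcases le_or_gt (1 / 2) c with hc | hc
  · have h1 : ∑ t ∈ Finset.range m, (Z (2 * t + 1) + (2 * c - 1) * Z (2 * t))
        ≤ ∑ t ∈ Finset.range m, (Z (2 * t) + Z (2 * t + 1)) :=
      Finset.sum_le_sum fun t _ => by nlinarith [hZ (2 * t)]
    nlinarith
  · have h1 : ∑ t ∈ Finset.range m, (Z (2 * t + 1) + (2 * c - 1) * Z (2 * t))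
        = ∑ t ∈ Finset.range m, (Z (2 * t + 1) - Z (2 * t))
          + 2 * c * ∑ t ∈ Finset.range m, Z (2 * t) := by
      rw [Finset.mul_sum, ← Finset.sum_add_distrib]
      exact Finset.sum_congr rfl fun t _ => by ring
    have h2 : ∑ t ∈ Finset.range m, Z (2 * t) ≤ B :=
      (Finset.sum_le_sum fun t _ => by linarith [hZ (2 * t + 1)]).trans hB1
    have h3 : ∑ t ∈ Finset.range m, (Z (2 * t + 1) - Z (2 * t)) ≤ 1 := by
      have e : ∑ t ∈ Finset.range m, (Z (2 * t + 1) - Z (2 * t))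
          = ∑ ℓ, (∑ t ∈ Finset.range m, (1 - c * lam ℓ) ^ (2 * t) * (1 - (1 - c * lam ℓ)))
            * (-(x ℓ * y ℓ)) := by
        simp only [Finset.sum_mul]
        rw [Finset.sum_comm]
        refine Finset.sum_congr rfl fun t _ => ?_
        rw [hZdef, hZdef, ← Finset.sum_sub_distrib]
        exact Finset.sum_congr rfl fun ℓ _ => by ring
      rw [e]
      have : ∑ ℓ, (∑ t ∈ Finset.range m, (1 - c * lam ℓ) ^ (2 * t) * (1 - (1 - c * lam ℓ)))
            * (-(x ℓ * y ℓ)) ≤ ∑ ℓ, (1 / 2) * (x ℓ * x ℓ + y ℓ * y ℓ) := by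
        refine Finset.sum_le_sum fun ℓ _ => ?_
        have z0 : 0 ≤ 1 - c * lam ℓ := by nlinarith [hl0 ℓ, hl2 ℓ]
        have z1 : 1 - c * lam ℓ ≤ 1 := by nlinarith [hl0 ℓ]
        obtain ⟨p, q⟩ := alt_sum _ z0 z1 m
        have q' := q.trans (sub_le_self 1 (pow_nonneg z0 _))
        have r1 : -(x ℓ * y ℓ) ≤ (1 / 2) * (x ℓ * x ℓ + y ℓ * y ℓ) := by
          nlinarith [sq_nonneg (x ℓ + y ℓ)]
        have r2 : 0 ≤ (1 / 2) * (x ℓ * x ℓ + y ℓ * y ℓ) := by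
          nlinarith [mul_self_nonneg (x ℓ), mul_self_nonneg (y ℓ)]
        exact (mul_le_mul_of_nonneg_left r1 p).trans (mul_le_of_le_one_left r2 q')
      refine this.trans ?_
      rw [← Finset.mul_sum, Finset.sum_add_distrib, hx, hy]
      norm_num
    rw [h1]
    nlinarith

theorem geom_le (x y lam : Fin n → ℝ) (i0 : Fin n) (I : Finset (Fin n))
    (hsplit : ∀ f : Fin n → ℝ, ∑ ℓ, f ℓ = f i0 + ∑ ℓ ∈ I, f ℓ)
    (c lam1 Λ : ℝ) (hc0 : 0 < c) (hlam1 : 0 < lam1) (hl1 : ∀ ℓ ∈ I, lam1 ≤ lam ℓ)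
    (hl0 : lam i0 = 0) (hΛ0 : 0 ≤ Λ) (hΛ : ∀ ℓ ∈ I, |1 - c * lam ℓ| ≤ Λ)
    (hx : ∑ ℓ, x ℓ * x ℓ = 1) (hy : ∑ ℓ, y ℓ * y ℓ = 1) (N : ℕ) :
    ∑ k ∈ Finset.range N, (∑ ℓ, (1 - c * lam ℓ) ^ k * (x ℓ * y ℓ))
      ≤ N * (x i0 * y i0) + (∑ ℓ ∈ I, 1 / lam ℓ * (x ℓ * y ℓ)) / c
        + Λ ^ N / (c * lam1) * (1 - x i0 * y i0) := by
  rw [Finset.sum_comm, hsplit, hl0]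
  have e0 : ∑ k ∈ Finset.range N, (1 - c * 0) ^ k * (x i0 * y i0) = N * (x i0 * y i0) := by simp
  rw [e0, add_assoc]
  refine add_le_add le_rfl ?_
  have e1 : ∀ ℓ ∈ I, ∑ k ∈ Finset.range N, (1 - c * lam ℓ) ^ k * (x ℓ * y ℓ)
      ≤ 1 / lam ℓ * (x ℓ * y ℓ) / c
        + Λ ^ N / (c * lam1) * ((1 / 2) * (x ℓ * x ℓ + y ℓ * y ℓ)) := by
    intro ℓ hℓ
    have hlp : 0 < lam ℓ := hlam1.trans_le (hl1 ℓ hℓ)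
    have hg : ∑ k ∈ Finset.range N, (1 - c * lam ℓ) ^ k
        = (1 - (1 - c * lam ℓ) ^ N) / (c * lam ℓ) := by
      rw [eq_div_iff (by positivity)]
      have := geom_sum_mul_neg (1 - c * lam ℓ) N
      rw [← this]; ring
    rw [← Finset.sum_mul, hg]
    have e2 : (1 - (1 - c * lam ℓ) ^ N) / (c * lam ℓ) * (x ℓ * y ℓ)
        = 1 / lam ℓ * (x ℓ * y ℓ) / c + (1 - c * lam ℓ) ^ N / (c * lam ℓ) * (-(x ℓ * y ℓ)) := by
      field_simp; ring
    rw [e2]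
    refine add_le_add le_rfl ((le_abs_self _).trans ?_)
    rw [abs_mul]
    refine mul_le_mul ?_ ?_ (abs_nonneg _) (by positivity)
    · rw [abs_div, abs_pow, abs_of_pos (show 0 < c * lam ℓ by positivity)]
      have p1 := pow_le_pow_left₀ (abs_nonneg _) (hΛ ℓ hℓ) N
      have p2 := mul_le_mul_of_nonneg_left (hl1 ℓ hℓ) hc0.le
      exact div_le_div₀ (by positivity) p1 (by positivity) p2
    · rw [abs_neg]
      refine abs_le.2 ⟨?_, ?_⟩
      · nlinarith [sq_nonneg (x ℓ + y ℓ)]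
      · nlinarith [sq_nonneg (x ℓ - y ℓ)]
  refine (Finset.sum_le_sum e1).trans ?_
  rw [Finset.sum_add_distrib, ← Finset.sum_div, ← Finset.mul_sum, ← Finset.mul_sum,
    Finset.sum_add_distrib]
  refine add_le_add le_rfl (mul_le_mul_of_nonneg_left ?_ (by positivity))
  rw [hsplit] at hx hy
  nlinarith [sq_nonneg (x i0 - y i0)]

/-- the spectral gap is at most one if two distinct nodes are non adjacent. -/
theorem gap_le_one (x y lam : Fin n → ℝ) (i0 : Fin n) (I : Finset (Fin n))
    (hsplit : ∀ f : Fin n → ℝ, ∑ ℓ, f ℓ = f i0 + ∑ ℓ ∈ I, f ℓ)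
    (lam1 p q : ℝ) (hp : 0 < p) (hq : 0 < q) (hl1 : ∀ ℓ ∈ I, lam1 ≤ lam ℓ)
    (hx : ∑ ℓ, x ℓ * x ℓ = 1) (hy : ∑ ℓ, y ℓ * y ℓ = 1) (hxy : ∑ ℓ, x ℓ * y ℓ = 0)
    (hx' : ∑ ℓ, (1 - lam ℓ) * (x ℓ * x ℓ) = 0) (hy' : ∑ ℓ, (1 - lam ℓ) * (y ℓ * y ℓ) = 0)
    (hxy' : ∑ ℓ, (1 - lam ℓ) * (x ℓ * y ℓ) = 0) (h0 : x i0 / p = y i0 / q) : lam1 ≤ 1 := by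
  by_contra! hlt
  have expand : ∀ f : Fin n → ℝ, ∑ ℓ, f ℓ * (x ℓ / p - y ℓ / q) ^ 2
      = (∑ ℓ, f ℓ * (x ℓ * x ℓ)) / p ^ 2 + (∑ ℓ, f ℓ * (y ℓ * y ℓ)) / q ^ 2
        - 2 / (p * q) * ∑ ℓ, f ℓ * (x ℓ * y ℓ) := by
    intro f
    rw [Finset.sum_div, Finset.sum_div, Finset.mul_sum, ← Finset.sum_add_distrib,
      ← Finset.sum_sub_distrib]
    refine Finset.sum_congr rfl fun ℓ _ => ?_
    field_simp
    ring
  have h1 := expand (fun ℓ => 1 - lam ℓ)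
  have h2 := expand (fun _ => 1)
  simp only [hx', hy', hxy'] at h1
  simp only [one_mul, hx, hy, hxy] at h2
  rw [hsplit, h0] at h1 h2
  simp only [sub_self, zero_div, mul_zero, add_zero, sub_zero, ne_eq, OfNat.ofNat_ne_zero,
    not_false_eq_true, zero_pow, zero_add] at h1 h2
  have h3 : (lam1 - 1) * ∑ ℓ ∈ I, (x ℓ / p - y ℓ / q) ^ 2
      ≤ - ∑ ℓ ∈ I, (1 - lam ℓ) * (x ℓ / p - y ℓ / q) ^ 2 := by
    rw [Finset.mul_sum, ← Finset.sum_neg_distrib]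
    refine Finset.sum_le_sum fun ℓ hℓ => ?_
    nlinarith [hl1 ℓ hℓ, sq_nonneg (x ℓ / p - y ℓ / q)]
  rw [h1, h2] at h3
  have h4 : 0 < (lam1 - 1) * (1 / p ^ 2 + 1 / q ^ 2) := by
    have : 0 < lam1 - 1 := by linarith
    positivity
  linarith

theorem Arw_apply (G : SimpleGraph (Fin n)) [DecidableRel G.Adj] (i j : Fin n) :
    Arw G i j = (G.degree i : ℝ)⁻¹ * (if G.Adj i j then 1 else 0) := by
  simp only [Arw, Matrix.diagonal_mul, SimpleGraph.adjMatrix_apply]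

theorem Asym_apply (G : SimpleGraph (Fin n)) [DecidableRel G.Adj] (i j : Fin n) :
    Asym G i j = (Real.sqrt (G.degree i))⁻¹ * (if G.Adj i j then 1 else 0)
      * (Real.sqrt (G.degree j))⁻¹ := by
  simp only [Asym, Matrix.mul_diagonal, Matrix.diagonal_mul, SimpleGraph.adjMatrix_apply]

theorem eig_rw (G : SimpleGraph (Fin n)) [DecidableRel G.Adj] (hdeg : ∀ i, 0 < (G.degree i : ℝ))
    (lam : Fin n → ℝ) (φ : Fin n → Fin n → ℝ)
    (heig : ∀ ℓ, (nLap G).mulVec (φ ℓ) = lam ℓ • φ ℓ) (ℓ i : Fin n) :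
    ∑ j, Arw G i j * (φ ℓ j / Real.sqrt (G.degree j))
      = (1 - lam ℓ) * (φ ℓ i / Real.sqrt (G.degree i)) := by
  have h := congrFun (heig ℓ) i
  simp only [nLap, Matrix.sub_mulVec, Matrix.one_mulVec, Pi.sub_apply, Pi.smul_apply,
    smul_eq_mul] at h
  have h1 : (Asym G).mulVec (φ ℓ) i = (1 - lam ℓ) * φ ℓ i := by linarith
  have h2 : ∀ j, Arw G i j * (φ ℓ j / Real.sqrt (G.degree j))
      = (Asym G i j * φ ℓ j) / Real.sqrt (G.degree i) := by
    intro j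
    rw [Arw_apply, Asym_apply]
    have hs := Real.sqrt_pos.2 (hdeg i)
    have hq : (G.degree i : ℝ)⁻¹
      = (Real.sqrt (G.degree i))⁻¹ * (Real.sqrt (G.degree i))⁻¹ := by
      rw [← mul_inv, Real.mul_self_sqrt (hdeg i).le]
    rw [hq]
    ring
  simp only [h2]
  rw [← Finset.sum_div]
  have h3 : ∑ j, Asym G i j * φ ℓ j = (1 - lam ℓ) * φ ℓ i := h1
  rw [h3]; ring


set_option maxHeartbeats 4000000

/-- depth lower bound for the random-walk normalized adjacency
matrix `𝒜 = D⁻¹A`. -/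
theorem depth_lower_bound_rw (hn : 1 < n)
    (G : SimpleGraph (Fin n)) [DecidableRel G.Adj] (hconn : G.Connected)
    (σ : ℝ → ℝ) (hσ : ContDiff ℝ 2 σ)
    (hσ' : ∀ x, |deriv σ x| ≤ 1) (hσ'' : ∀ x, |deriv (deriv σ) x| ≤ 1)
    (Ω W : ℕ → EuclideanSpace ℝ (Fin d) →L[ℝ] EuclideanSpace ℝ (Fin d))
    (ω w : ℝ) (hw : 0 < w) (hΩ : ∀ t, ‖Ω t‖ ≤ ω) (hW : ∀ t, ‖W t‖ ≤ w)
    (ψ : ℕ → EuclideanSpace ℝ (Fin d) × EuclideanSpace ℝ (Fin d) → EuclideanSpace ℝ (Fin d))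
    (hψ : ∀ t, ContDiff ℝ 2 (ψ t)) (c₁ c₂ c2 : ℝ) (hc₂0 : 0 < c₂) (hc₂1 : c₂ ≤ 1)
    (hψ₁ : ∀ t x y, ‖fderiv ℝ (fun z => ψ t (z, y)) x‖ ≤ c₁)
    (hψ₂ : ∀ t x y, ‖fderiv ℝ (fun z => ψ t (x, z)) y‖ ≤ c₂)
    (hψ₃ : ∀ t p, ‖iteratedFDeriv ℝ 2 (ψ t) p‖ ≤ c2)
    (γ' : ℝ) (hγ' : γ' = (G.maxDegree : ℝ) / (G.minDegree : ℝ))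
    (hw1 : w ≤ 1) (hcap : ω / w + c₁ + c₂ ≤ 1)
    (lam : Fin n → ℝ) (φ : Fin n → Fin n → ℝ)
    (horth : ∀ k l, ∑ a, φ k a * φ l a = if k = l then (1 : ℝ) else 0)
    (heig : ∀ ℓ, (nLap G).mulVec (φ ℓ) = lam ℓ • φ ℓ)
    (hmono : Monotone lam)
    (hlam0 : lam ⟨0, by omega⟩ = 0)
    (hlampos : ∀ ℓ : Fin n, (ℓ : ℕ) ≠ 0 → 0 < lam ℓ)
    (hlamlt : ∀ ℓ, lam ℓ < 2)
    (hφ0 : ∀ a, φ ⟨0, by omega⟩ a = Real.sqrt ((G.degree a : ℝ) / (2 * G.edgeFinset.card)))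
    (Λ : ℝ)
    (hΛ : IsGreatest {x : ℝ | ∃ ℓ : Fin n, (ℓ : ℕ) ≠ 0 ∧ x = |1 - c₂ * lam ℓ|} Λ)
    (μ' : ℝ) (hμ' : μ' = 1 + 2 * c2 * (1 + γ'))
    (v u : Fin n) (hvu : v ≠ u) (r : ℕ) (hr : r = G.dist v u)
    (θ : EuclideanSpace ℝ (Fin d)) (hθ : ‖θ‖ = 1)
    (m : ℕ) (M : ℝ) (hM : 0 < M)
    (X : Fin n → EuclideanSpace ℝ (Fin d)) (α β : Fin d)
    (hmix : M ≤ |OSQ.mixEntry θ σ (Arw G) Ω W ψ m v u X α β|) :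
    (m : ℝ) ≥ commuteTime G lam φ v u / (4 * c₂)
        + (G.edgeFinset.card : ℝ) / Real.sqrt ((G.degree v : ℝ) * (G.degree u : ℝ)) *
            (M / (γ' * μ')
              - (1 / c₂) * ((γ' + Λ ^ (r - 1)) / lam ⟨1, hn⟩ + 2 * c2 / μ')) := by
  classical
  haveI : NeZero n := ⟨by omega⟩
  haveI : Nontrivial (Fin n) := Fin.nontrivial_iff_two_le.2 hn
  have hdegN : ∀ i, 0 < G.degree i := fun i => hconn.preconnected.degree_pos_of_nontrivial i
  have hdeg : ∀ i, 0 < (G.degree i : ℝ) := fun i => by exact_mod_cast hdegN i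
  have hc3 : 0 ≤ c2 := (norm_nonneg _).trans (hψ₃ 0 0)
  set s : Fin n → ℝ := fun i => Real.sqrt (G.degree i) with hsdef
  have hs : ∀ i, 0 < s i := fun i => Real.sqrt_pos.2 (hdeg i)
  have hs2 : ∀ i, s i ^ 2 = G.degree i := fun i => Real.sq_sqrt (hdeg i).le
  have hA0 : ∀ i j, 0 ≤ Arw G i j := by
    intro i j
    rw [Arw_apply]
    have := hdeg i
    split_ifs <;> positivity
  have hA1 : ∀ i, ∑ j, Arw G i j = 1 := by
    intro i
    simp only [Arw_apply]
    rw [← Finset.mul_sum, Finset.sum_boole]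
    have : ({j | G.Adj i j} : Finset (Fin n)).card = G.degree i := by
      rw [← SimpleGraph.card_neighborFinset_eq_degree]
      congr 1
      ext j; simp
    rw [this]
    exact inv_mul_cancel₀ (hdeg i).ne'
  have hAz : ∀ i j, ¬ G.Adj i j → Arw G i j = 0 := by
    intro i j h
    rw [Arw_apply, if_neg h, mul_zero]
  have hsym : ∀ i j, s i ^ 2 * Arw G i j = s j ^ 2 * Arw G j i := by
    intro i j
    rw [hs2, hs2, Arw_apply, Arw_apply, mul_inv_cancel_left₀ (hdeg i).ne',
      mul_inv_cancel_left₀ (hdeg j).ne']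
    simp [G.adj_comm]
  have heig' := eig_rw G hdeg lam φ heig
  have hcomp := complete_of_orth φ horth
  -- the analytic bound
  set av : ℕ → Fin n → ℝ := fun t i => gv φ s (fun ℓ => (1 - c₂ * lam ℓ) ^ t) v i with hav
  set bv : ℕ → Fin n → ℝ := fun t i => gv φ s (fun ℓ => (1 - c₂ * lam ℓ) ^ t) u i with hbv
  have hdir : ∀ (p : Fin n) (γ : Fin d) (i : Fin n),
      ‖(dir p γ : Fin n → EuclideanSpace ℝ (Fin d)) i‖
        ≤ gv φ s (fun ℓ => (1 - c₂ * lam ℓ) ^ 0) p i := by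
    intro p γ i
    simp only [pow_zero]
    rw [gv_one φ s hs horth]
    by_cases h : i = p
    · subst h; simp [dir]
    · simp [dir, h]
  have hbd := mpnn_bd (Arw G) hA0 hA1 σ hσ hσ' hσ'' Ω W ω w hw hΩ hW ψ hψ c₁ c₂ c2 hψ₁ hψ₂ hψ₃
    hw1 hcap (dir u β) (dir v α) av bv (hdir v α) (hdir u β)
    (fun t i => gv_step φ s lam (Arw G) heig' c₂ t v i)
    (fun t i => gv_step φ s lam (Arw G) heig' c₂ t u i) m
  have hMH := hmix.trans (mix_le θ hθ σ (Arw G) Ω W ψ m v u X α β _ _ _ hbd)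
  have hH0 : ∀ i, 0 ≤ Hb c₂ c2 (Arw G) av bv m i := fun i =>
    (norm_nonneg _).trans ((hbd i).2 0).2.2
  -- degrees
  have hminN : 0 < G.minDegree := hconn.preconnected.minDegree_pos_of_nontrivial
  have hmin : 0 < (G.minDegree : ℝ) := by exact_mod_cast hminN
  have hminle : ∀ i, (G.minDegree : ℝ) ≤ G.degree i := fun i => by
    exact_mod_cast G.minDegree_le_degree i
  have hmaxle : ∀ i, (G.degree i : ℝ) ≤ G.maxDegree := fun i => by
    exact_mod_cast G.degree_le_maxDegree i
  have hγ1 : 1 ≤ γ' := by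
    rw [hγ', le_div_iff₀ hmin, one_mul]
    exact (hminle v).trans (hmaxle v)
  have hγmin : γ' * G.minDegree = G.maxDegree := by rw [hγ']; field_simp
  have hsle : ∀ i j, s i ≤ γ' * s j := by
    intro i j
    refine abs_le_of_sq_le_sq' ?_ (by have := hs j; positivity) |>.2
    rw [mul_pow, hs2, hs2]
    have h1 : (G.degree i : ℝ) ≤ γ' * G.degree j :=
      (hmaxle i).trans (hγmin ▸ mul_le_mul_of_nonneg_left (hminle j) (by linarith))
    have h2 : γ' * G.degree j ≤ γ' ^ 2 * G.degree j := by
      have := hdeg j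
      nlinarith [mul_nonneg (mul_nonneg (by linarith : (0:ℝ) ≤ γ') (by linarith : 0 ≤ γ' - 1)) this.le]
    linarith
  have hss : s v * s u ≤ γ' * G.minDegree := by
    rw [hγmin]
    have h1 : ∀ i, s i ≤ Real.sqrt G.maxDegree := fun i => Real.sqrt_le_sqrt (hmaxle i)
    calc s v * s u ≤ Real.sqrt G.maxDegree * Real.sqrt G.maxDegree :=
          mul_le_mul (h1 v) (h1 u) (hs u).le (Real.sqrt_nonneg _)
      _ = G.maxDegree := Real.mul_self_sqrt (Nat.cast_nonneg _)
  -- `M * d_min ≤ K`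
  have hK := K_formula φ s lam hs horth (Arw G) hA1 hsym heig' c₂ c2 v u m
  set Z : ℕ → ℝ := fun k => ∑ ℓ, (1 - c₂ * lam ℓ) ^ k * (φ ℓ v * φ ℓ u) with hZdef
  set Tot : ℝ := ∑ t ∈ Finset.range m, (Z (2 * t + 2) + 2 * c2 * (Z (2 * t)
      + ∑ ℓ, (1 - c₂ * lam ℓ) ^ (2 * t) * (1 - lam ℓ) * (φ ℓ v * φ ℓ u))) with hTot
  have hMK : M * G.minDegree ≤ s v * s u * Tot := by
    rw [hTot, ← hK, mul_comm]
    refine (mul_le_mul_of_nonneg_left hMH hmin.le).trans ?_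
    rw [Finset.mul_sum]
    refine Finset.sum_le_sum fun i _ => ?_
    rw [hs2]
    exact mul_le_mul_of_nonneg_right (hminle i) (hH0 i)
  have hssp : 0 < s v * s u := mul_pos (hs v) (hs u)
  have hTotp : 0 < Tot := by
    have : 0 < s v * s u * Tot := (mul_pos hM hmin).trans_le hMK
    exact (pos_iff_pos_of_mul_pos this).1 hssp
  have hMγ : M ≤ γ' * Tot := by
    have h1 : s v * s u * Tot ≤ γ' * G.minDegree * Tot := mul_le_mul_of_nonneg_right hss hTotp.le
    have h2 : M * G.minDegree ≤ (γ' * Tot) * G.minDegree := by linarith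
    exact le_of_mul_le_mul_right h2 hmin
  -- facts about `Z`
  have hZgv : ∀ k, Z k = s u / s v * gv φ s (fun ℓ => (1 - c₂ * lam ℓ) ^ k) v u := by
    intro k
    have h1 := (hs u).ne'
    have h2 := (hs v).ne'
    have : ∑ ℓ, (1 - c₂ * lam ℓ) ^ k * (φ ℓ u * φ ℓ v) = Z k :=
      Finset.sum_congr rfl fun ℓ _ => by ring
    rw [gv, this]
    field_simp
  have hZ0 : ∀ k, 0 ≤ Z k := fun k => by
    rw [hZgv]
    exact mul_nonneg (div_nonneg (hs u).le (hs v).le)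
      (gv_nonneg φ s lam hs horth (Arw G) hA0 heig' c₂ hc₂0.le hc₂1 v k u)
  have hZr : ∀ k, k < r → Z k = 0 := fun k hk => by
    rw [hZgv, gv_zero G hconn φ s lam hs horth (Arw G) hAz heig' c₂ v k u (hr ▸ hk), mul_zero]
  have hr1 : 1 ≤ r := hr ▸ hconn.pos_dist_of_ne hvu
  have h2m : r ≤ 2 * m := by
    by_contra! hlt
    have : Tot ≤ 0 := by
      refine Finset.sum_nonpos fun t ht => ?_
      have ht' := Finset.mem_range.1 ht
      rw [hZr _ (by omega), hZr _ (by omega), zero_add, zero_add]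
      have hW : c₂ * ∑ ℓ, (1 - c₂ * lam ℓ) ^ (2 * t) * (1 - lam ℓ) * (φ ℓ v * φ ℓ u)
          = Z (2 * t + 1) - (1 - c₂) * Z (2 * t) := by
        rw [hZdef, Finset.mul_sum, Finset.mul_sum, ← Finset.sum_sub_distrib]
        exact Finset.sum_congr rfl fun ℓ _ => by ring
      rw [hZr _ (by omega), hZr _ (by omega)] at hW
      have : ∑ ℓ, (1 - c₂ * lam ℓ) ^ (2 * t) * (1 - lam ℓ) * (φ ℓ v * φ ℓ u) = 0 := by
        rcases mul_eq_zero.1 (hW.trans (by ring)) with h | h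
        · exact absurd h hc₂0.ne'
        · exact h
      rw [this, mul_zero]
    linarith
  -- spectral data
  set i0 : Fin n := ⟨0, by omega⟩ with hi0
  set I : Finset (Fin n) := Finset.univ.filter (fun ℓ : Fin n => (ℓ : ℕ) ≠ 0) with hI
  have hIe : I = Finset.univ.erase i0 := by
    ext ℓ
    simp only [I, Finset.mem_filter, Finset.mem_univ, true_and, Finset.mem_erase, and_true,
      ne_eq, Fin.ext_iff]
    exact Iff.rfl
  have hsplit : ∀ f : Fin n → ℝ, ∑ ℓ, f ℓ = f i0 + ∑ ℓ ∈ I, f ℓ := by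
    intro f
    rw [hIe, Finset.add_sum_erase _ _ (Finset.mem_univ _)]
  have hImem : ∀ ℓ ∈ I, (ℓ : ℕ) ≠ 0 := fun ℓ h => by simpa [hI] using h
  set l1 : ℝ := lam ⟨1, hn⟩ with hl1
  have hl1p : 0 < l1 := hlampos _ (by simp)
  have hl1I : ∀ ℓ ∈ I, l1 ≤ lam ℓ := fun ℓ h => hmono (by
    rw [Fin.le_def]; have := hImem ℓ h; simp only; omega)
  have hl1lt : l1 < 2 := hlamlt _
  have hΛI : ∀ ℓ ∈ I, |1 - c₂ * lam ℓ| ≤ Λ := fun ℓ h => hΛ.2 ⟨ℓ, hImem ℓ h, rfl⟩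
  have hΛ01 : 0 ≤ Λ ∧ Λ ≤ 1 := by
    obtain ⟨ℓ, h, e⟩ := hΛ.1
    rw [e]
    refine ⟨abs_nonneg _, abs_le.2 ⟨?_, ?_⟩⟩
    · nlinarith [hlampos ℓ h, hlamlt ℓ]
    · nlinarith [hlampos ℓ h]
  obtain ⟨hΛ0, hΛ1⟩ := hΛ01
  have hxx : ∀ i, ∑ ℓ, φ ℓ i * φ ℓ i = 1 := fun i => by rw [hcomp]; simp
  have hxy : ∑ ℓ, φ ℓ v * φ ℓ u = 0 := by rw [hcomp, if_neg hvu]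
  -- edges
  have hEp : 0 < (G.edgeFinset.card : ℝ) := by
    have h1 := G.sum_degrees_eq_twice_card_edges
    have h2 : G.degree v ≤ ∑ i, G.degree i :=
      Finset.single_le_sum (f := fun i => G.degree i) (fun _ _ => Nat.zero_le _) (Finset.mem_univ v)
    have := hdegN v
    have h3 : 0 < G.edgeFinset.card := by omega
    exact_mod_cast h3
  set Ec : ℝ := (G.edgeFinset.card : ℝ) with hEc
  have hφs : ∀ i, φ i0 i = s i / Real.sqrt (2 * Ec) := fun i => by
    rw [hφ0 i, Real.sqrt_div (hdeg i).le]
  have h2E : Real.sqrt (2 * Ec) ^ 2 = 2 * Ec := Real.sq_sqrt (by positivity)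
  have h2Ep : 0 < Real.sqrt (2 * Ec) := Real.sqrt_pos.2 (by positivity)
  set S : ℝ := φ i0 v * φ i0 u with hS
  have hSval : S = s v * s u / (2 * Ec) := by
    rw [hS, hφs, hφs, div_mul_div_comm, ← sq, h2E]
  have hS0 : 0 < S := by rw [hSval]; positivity
  have hS1 : S ≤ 1 := by
    have h1 := hxx v
    have h2 := hxx u
    rw [hsplit] at h1 h2
    have h3 : 0 ≤ ∑ ℓ ∈ I, φ ℓ v * φ ℓ v := Finset.sum_nonneg fun _ _ => mul_self_nonneg _
    have h4 : 0 ≤ ∑ ℓ ∈ I, φ ℓ u * φ ℓ u := Finset.sum_nonneg fun _ _ => mul_self_nonneg _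
    nlinarith [sq_nonneg (φ i0 v - φ i0 u)]
  have hgap : 2 ≤ r → l1 ≤ 1 := by
    intro h2
    have hAent : ∀ i k, Arw G i k = s k / s i * ∑ ℓ, (1 - lam ℓ) * (φ ℓ i * φ ℓ k) := by
      intro i k
      have h1 := gv_A φ s lam (Arw G) heig' (fun _ => 1) k i
      simp only [gv_one φ s hs horth, one_mul] at h1
      simpa [gv] using h1
    have hz : ∀ i k, ¬ G.Adj i k → ∑ ℓ, (1 - lam ℓ) * (φ ℓ i * φ ℓ k) = 0 := by
      intro i k h
      have h1 := hAent i k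
      rw [hAz i k h] at h1
      have h3 : s k / s i ≠ 0 := (div_pos (hs k) (hs i)).ne'
      exact (mul_eq_zero.1 h1.symm).resolve_left h3
    have hnadj : ¬ G.Adj v u := fun h => by
      have := SimpleGraph.dist_eq_one_iff_adj.2 h
      omega
    refine gap_le_one (fun ℓ => φ ℓ v) (fun ℓ => φ ℓ u) lam i0 I hsplit l1 (s v) (s u) (hs v) (hs u)
      hl1I (hxx v) (hxx u) hxy (hz v v (G.loopless.irrefl v)) (hz u u (G.loopless.irrefl u)) (hz v u hnadj) ?_
    simp only [hφs]
    have h3 := (hs v).ne'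
    have h4 := (hs u).ne'
    field_simp
  -- the quantity B
  set Lp : ℝ := ∑ ℓ ∈ I, 1 / lam ℓ * (φ ℓ v * φ ℓ u) with hLp
  set τ : ℝ := commuteTime G lam φ v u with hτ
  set Λr : ℝ := Λ ^ (r - 1) with hΛr
  set B : ℝ := 2 * m * S - τ * (s v * s u) / (4 * c₂ * Ec) + (γ' + Λr) / (c₂ * l1) with hB
  have hτval : τ * (s v * s u) / (4 * c₂ * Ec)
      = (1 / (2 * c₂)) * (∑ ℓ ∈ I, 1 / lam ℓ * (s u / s v * (φ ℓ v * φ ℓ v)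
          + s v / s u * (φ ℓ u * φ ℓ u))) - Lp / c₂ := by
    have h1 : τ = 2 * Ec * ∑ ℓ ∈ I, (1 / lam ℓ) * (φ ℓ v / s v - φ ℓ u / s u) ^ 2 := rfl
    have h2 : τ * (s v * s u) / (4 * c₂ * Ec) = (1 / (2 * c₂)) *
        ∑ ℓ ∈ I, (s v * s u) * ((1 / lam ℓ) * (φ ℓ v / s v - φ ℓ u / s u) ^ 2) := by
      rw [h1, ← Finset.mul_sum]; field_simp; ring
    have h3 : Lp / c₂ = (1 / (2 * c₂)) * ∑ ℓ ∈ I, 2 * (1 / lam ℓ * (φ ℓ v * φ ℓ u)) := by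
      rw [← Finset.mul_sum, hLp]; field_simp
    rw [h2, h3, ← mul_sub, ← Finset.sum_sub_distrib]
    congr 1
    refine Finset.sum_congr rfl fun ℓ _ => ?_
    have h4 := (hs v).ne'
    have h5 := (hs u).ne'
    field_simp
    ring
  have hslack : ∑ ℓ ∈ I, 1 / lam ℓ * (s u / s v * (φ ℓ v * φ ℓ v)
          + s v / s u * (φ ℓ u * φ ℓ u)) ≤ 2 * (γ' - S) / l1 := by
    have hp1 : 0 < s u / s v := div_pos (hs u) (hs v)
    have hp2 : 0 < s v / s u := div_pos (hs v) (hs u)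
    have h1 : ∑ ℓ ∈ I, 1 / lam ℓ * (s u / s v * (φ ℓ v * φ ℓ v)
          + s v / s u * (φ ℓ u * φ ℓ u)) ≤ ∑ ℓ ∈ I, 1 / l1 * (s u / s v * (φ ℓ v * φ ℓ v)
          + s v / s u * (φ ℓ u * φ ℓ u)) := by
      refine Finset.sum_le_sum fun ℓ hℓ => ?_
      refine mul_le_mul_of_nonneg_right (one_div_le_one_div_of_le hl1p (hl1I ℓ hℓ)) ?_
      exact add_nonneg (mul_nonneg hp1.le (mul_self_nonneg _)) (mul_nonneg hp2.le (mul_self_nonneg _))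
    refine h1.trans ?_
    rw [← Finset.mul_sum, Finset.sum_add_distrib, ← Finset.mul_sum, ← Finset.mul_sum]
    have h2 := hxx v
    have h3 := hxx u
    rw [hsplit] at h2 h3
    have h4 : s u / s v * (φ i0 v * φ i0 v) = S := by
      rw [hS, hφs, hφs]
      have := (hs v).ne'
      field_simp
    have h5 : s v / s u * (φ i0 u * φ i0 u) = S := by
      rw [hS, hφs, hφs]
      have := (hs u).ne'
      field_simp
    have h6 : s u / s v ≤ γ' := by rw [div_le_iff₀ (hs v)]; exact hsle u v
    have h7 : s v / s u ≤ γ' := by rw [div_le_iff₀ (hs u)]; exact hsle v u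
    have h8 : ∑ ℓ ∈ I, φ ℓ v * φ ℓ v = 1 - φ i0 v * φ i0 v := by linarith
    have h9 : ∑ ℓ ∈ I, φ ℓ u * φ ℓ u = 1 - φ i0 u * φ i0 u := by linarith
    rw [h8, h9, mul_sub, mul_sub, h4, h5, one_div, inv_mul_eq_div]
    exact div_le_div_of_nonneg_right (by linarith) hl1p.le
  have hBge : 2 * m * S + Lp / c₂ + (Λr + S) / (c₂ * l1) ≤ B := by
    rw [hB, hτval]
    have h1 : (1 / (2 * c₂)) * (∑ ℓ ∈ I, 1 / lam ℓ * (s u / s v * (φ ℓ v * φ ℓ v)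
          + s v / s u * (φ ℓ u * φ ℓ u))) ≤ (1 / (2 * c₂)) * (2 * (γ' - S) / l1) :=
      mul_le_mul_of_nonneg_left hslack (by positivity)
    have h2 : (1 / (2 * c₂)) * (2 * (γ' - S) / l1) = (γ' + Λr) / (c₂ * l1) - (Λr + S) / (c₂ * l1) := by
      field_simp; ring
    linarith
  have hgeom := geom_le (fun ℓ => φ ℓ v) (fun ℓ => φ ℓ u) lam i0 I hsplit c₂ l1 Λ hc₂0 hl1p hl1I
    hlam0 hΛ0 hΛI (hxx v) (hxx u)
  have hcl : 0 < c₂ * l1 := by positivity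
  have hpow : ∀ N, r - 1 ≤ N → Λ ^ N ≤ Λr := fun N h => pow_le_pow_of_le_one hΛ0 hΛ1 h
  have hB1 : ∑ k ∈ Finset.range (2 * m), Z k ≤ B := by
    refine (hgeom (2 * m)).trans (le_trans ?_ hBge)
    have h1 : Λ ^ (2 * m) * (1 - S) ≤ Λr + S := by
      have := hpow (2 * m) (by omega)
      have h0 : 0 ≤ Λ ^ (2 * m) := pow_nonneg hΛ0 _
      nlinarith
    have h2 : Λ ^ (2 * m) / (c₂ * l1) * (1 - S) ≤ (Λr + S) / (c₂ * l1) := by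
      rw [div_mul_eq_mul_div]
      exact div_le_div_of_nonneg_right h1 hcl.le
    push_cast
    linarith
  have hB2 : ∑ k ∈ Finset.range (2 * m + 1), Z k ≤ B := by
    refine (hgeom (2 * m + 1)).trans (le_trans ?_ hBge)
    have h0 : 0 ≤ Λ ^ (2 * m + 1) := pow_nonneg hΛ0 _
    have h1 : S * (c₂ * l1) + Λ ^ (2 * m + 1) * (1 - S) ≤ Λr + S := by
      rcases Nat.lt_or_ge r 2 with h | h
      · have hr' : r - 1 = 0 := by omega
        have e1 : Λr = 1 := by rw [hΛr, hr', pow_zero]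
        have e2 : Λ ^ (2 * m + 1) ≤ 1 := pow_le_one₀ hΛ0 hΛ1
        have e3 : c₂ * l1 ≤ 2 := by nlinarith
        rw [e1]
        nlinarith [mul_nonneg hS0.le (sub_nonneg.2 e3),
          mul_nonneg (sub_nonneg.2 hS1) (sub_nonneg.2 e2)]
      · have e1 := hpow (2 * m + 1) (by omega)
        have e2 := hgap h
        have e3 : c₂ * l1 ≤ 1 := by nlinarith
        nlinarith [mul_nonneg hS0.le (sub_nonneg.2 e3), mul_nonneg h0 hS0.le]
    have h2 : S + Λ ^ (2 * m + 1) / (c₂ * l1) * (1 - S) ≤ (Λr + S) / (c₂ * l1) := by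
      have e : S + Λ ^ (2 * m + 1) / (c₂ * l1) * (1 - S)
          = (S * (c₂ * l1) + Λ ^ (2 * m + 1) * (1 - S)) / (c₂ * l1) := by field_simp
      rw [e]
      exact div_le_div_of_nonneg_right h1 hcl.le
    push_cast
    linarith
  have hl0all : ∀ ℓ, 0 ≤ lam ℓ := fun ℓ => by
    by_cases h : (ℓ : ℕ) = 0
    · have : ℓ = i0 := Fin.ext h
      rw [this, hlam0]
    · exact (hlampos ℓ h).le
  have hTB : Tot ≤ B + 2 * c2 * (2 * B + 1 / c₂) :=
    tot_le (fun ℓ => φ ℓ v) (fun ℓ => φ ℓ u) lam c₂ c2 B hc₂0 hc₂1 hc3 hl0all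
      (fun ℓ => (hlamlt ℓ).le) (hxx v) (hxx u) m Z (fun _ => rfl) hZ0 hB1 hB2
  have hBnn : 0 ≤ B := (Finset.sum_nonneg fun k _ => hZ0 k).trans hB1
  have hμp : 0 < μ' := by rw [hμ']; positivity
  have hTB' : Tot ≤ μ' * (B + (1 / c₂) * (2 * c2 / μ')) := by
    have e : μ' * (B + (1 / c₂) * (2 * c2 / μ')) = μ' * B + 2 * c2 * (1 / c₂) := by
      field_simp
    rw [e, hμ']
    have : 0 ≤ 2 * c2 * B * (γ' - 1) :=
      mul_nonneg (by positivity) (by linarith)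
    linarith
  have hγp : 0 < γ' := by linarith
  have hfin : M / (γ' * μ') ≤ B + (1 / c₂) * (2 * c2 / μ') := by
    rw [div_le_iff₀ (by positivity)]
    calc M ≤ γ' * Tot := hMγ
      _ ≤ γ' * (μ' * (B + (1 / c₂) * (2 * c2 / μ'))) := mul_le_mul_of_nonneg_left hTB' hγp.le
      _ = _ := by ring
  have hsq : Real.sqrt ((G.degree v : ℝ) * (G.degree u : ℝ)) = s v * s u :=
    Real.sqrt_mul (hdeg v).le _
  rw [hsq]
  have hle : M / (γ' * μ') - (1 / c₂) * ((γ' + Λr) / l1 + 2 * c2 / μ')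
      ≤ (s v * s u / Ec) * (m - τ / (4 * c₂)) := by
    have e1 : (s v * s u / Ec) * (m - τ / (4 * c₂))
        = 2 * m * S - τ * (s v * s u) / (4 * c₂ * Ec) := by
      rw [hSval]; field_simp
    have e2 : (1 / c₂) * ((γ' + Λr) / l1 + 2 * c2 / μ')
        = (γ' + Λr) / (c₂ * l1) + (1 / c₂) * (2 * c2 / μ') := by
      field_simp
    rw [e1, e2]
    rw [hB] at hfin
    linarith
  have hfac : 0 ≤ Ec / (s v * s u) := by positivity
  have h1 := mul_le_mul_of_nonneg_left hle hfac
  have e3 : Ec / (s v * s u) * ((s v * s u / Ec) * (m - τ / (4 * c₂))) = m - τ / (4 * c₂) := by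
    rw [← mul_assoc, div_mul_div_cancel₀ hssp.ne', div_self hEp.ne', one_mul]
  rw [e3] at h1
  change τ / (4 * c₂) + _ ≤ (m : ℝ)
  linarith
end OSQ
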